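/- Let G and H be finite metacyclic groups. If ℚG and ℚH are isomorphic as ℚ-algebras, then (m^G)_{π'_G} = (m^H)_{π'_H}, and R^G = R^H as subgroups of the unit group (ℤ/(m^G)_{π'_G}ℤ)ˣ. -/

import Mathlib

open scoped Classical

noncomputable section

namespace ArXiv230800432

/-- The `σ`-part of a natural number: product of `p ^ vₚ(n)` over primes `p ∈ σ` dividing `n`. -/
def natPart (n : ℕ) (σ : Set ℕ) : ℕ :=
  ∏ p ∈ n.primeFactors, if p ∈ σ then p ^ (n.factorization p) else 1

/-- A metacyclic factorization `G = A·B` with `A` cyclic normal and `B` cyclic. -/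
structure MetacyclicFact (G : Type*) [Group G] where
  A : Subgroup G
  B : Subgroup G
  normalA : A.Normal
  cyclicA : IsCyclic A
  cyclicB : IsCyclic B
  mul_cover : ∀ g : G, ∃ x ∈ A, ∃ y ∈ B, g = x * y

/-- A group is metacyclic if it admits a metacyclic factorization. -/
def IsMetacyclic (G : Type*) [Group G] : Prop :=
  Nonempty (MetacyclicFact G)

variable {G : Type*} [Group G]

/-- `π_G`: primes `p` dividing `|G|` such that `G` has a normal Hall `p'`-subgroup. -/
def piSet (G : Type*) [Group G] : Set ℕ :=
  {p | p.Prime ∧ p ∣ Nat.card G ∧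
    ∃ N : Subgroup G, N.Normal ∧ Nat.card N = ordCompl[p] (Nat.card G)}

/-- `π'_G = π(G) \ π_G`. -/
def piSet' (G : Type*) [Group G] : Set ℕ :=
  {p | p.Prime ∧ p ∣ Nat.card G} \ piSet G

/-- The image mod `d` of `T_G(A)`: classes `[t]_d` such that some `g ∈ G` acts on `A` by
conjugation as `x ↦ x ^ t`.  For `d = |A|` this is exactly `T_G(A)`. -/
def TGmod (A : Subgroup G) (d : ℕ) : Subgroup (ZMod d)ˣ :=
  Subgroup.closure
    {u : (ZMod d)ˣ | ∃ g : G, ∃ t : ℕ, ((t : ZMod d) = (u : ZMod d)) ∧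
      ∀ x ∈ A, g⁻¹ * x * g = x ^ t}

/-- `T_G(A)` as subgroup of `(ℤ/|A|ℤ)ˣ`. -/
def TG (A : Subgroup G) : Subgroup (ZMod (Nat.card A))ˣ :=
  TGmod A (Nat.card A)

/-- The image of `T` under `Res_q : (ℤ/dℤ)ˣ → (ℤ/qℤ)ˣ` is trivial. -/
def resTriv (d q : ℕ) (T : Subgroup (ZMod d)ˣ) : Prop :=
  ∀ u ∈ T, ∀ t : ℕ, ((t : ZMod d) = (u : ZMod d)) → (t : ZMod q) = 1

/-- The image of `T` under `Res_q` is contained in `⟨-1⟩`. -/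
def resInPMOne (d q : ℕ) (T : Subgroup (ZMod d)ˣ) : Prop :=
  ∀ u ∈ T, ∀ t : ℕ, ((t : ZMod d) = (u : ZMod d)) →
    ((t : ZMod q) = 1 ∨ (t : ZMod q) = -1)

/-- The image of `T` under `Res_q` as a set of units mod `q`. -/
def resSet (d q : ℕ) (T : Subgroup (ZMod d)ˣ) : Set (ZMod q)ˣ :=
  {v | ∃ u ∈ T, ∃ t : ℕ, ((t : ZMod d) = (u : ZMod d)) ∧ ((t : ZMod q) = (v : ZMod q))}

/-- The set of natural numbers representing elements of `T ≤ (ℤ/dℤ)ˣ`. -/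
def liftSet {d : ℕ} (T : Subgroup (ZMod d)ˣ) : Set ℕ :=
  {t | ∃ u ∈ T, (t : ZMod d) = (u : ZMod d)}

/-- `r^G(A)`: the greatest divisor `r` of `|A|` such that `Res_{r_{2'}}(T_G(A)) = 1` and
`Res_{r_2}(T_G(A)) ⊆ ⟨-1⟩`. -/
def rOfA (A : Subgroup G) : ℕ :=
  sSup {r : ℕ | r ∣ Nat.card A ∧ resTriv (Nat.card A) (ordCompl[2] r) (TG A) ∧
    resInPMOne (Nat.card A) (ordProj[2] r) (TG A)}

/-- `ε^G(A)`: `-1` if `Res_{r_2}(T_G(A)) ≠ 1`, and `1` otherwise. -/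
def epsOfA (A : Subgroup G) : ℤ :=
  if resTriv (Nat.card A) (ordProj[2] (rOfA A)) (TG A) then 1 else -1

/-- `k^G(A)`: order of the image of `T_G(A)` in `(ℤ/m_ν ℤ)ˣ`, `ν` the primes dividing `|A|`
but not `r^G(A)`. -/
def kOfA (A : Subgroup G) : ℕ :=
  (resSet (Nat.card A) (natPart (Nat.card A) {p | ¬ p ∣ rOfA A}) (TG A)).ncard

/-- The triple `(|A|, r^G(A), [G:B])` attached to a metacyclic factorization. -/
def factTriple (f : MetacyclicFact G) : ℕ × ℕ × ℕ :=
  (Nat.card f.A, rOfA f.A, f.B.index)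

/-- Lexicographic order on triples. -/
def lex3 (x y : ℕ × ℕ × ℕ) : Prop :=
  x.1 < y.1 ∨ (x.1 = y.1 ∧ (x.2.1 < y.2.1 ∨ (x.2.1 = y.2.1 ∧ x.2.2 ≤ y.2.2)))

/-- A metacyclic factorization is minimal when its triple is lexicographically minimal. -/
def IsMinimalFact (f : MetacyclicFact G) : Prop :=
  ∀ f' : MetacyclicFact G, lex3 (factTriple f) (factTriple f')

def mOf (f : MetacyclicFact G) : ℕ := Nat.card f.A
def nOf (f : MetacyclicFact G) : ℕ := f.A.index
def sOf (f : MetacyclicFact G) : ℕ := f.B.index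
def rOf (f : MetacyclicFact G) : ℕ := rOfA f.A
def epsOf (f : MetacyclicFact G) : ℤ := epsOfA f.A
def kOf (f : MetacyclicFact G) : ℕ := kOfA f.A

/-- The `σ`-part of an element of a finite group. -/
def elemPart (σ : Set ℕ) (g : G) : G :=
  g ^ ((orderOf g / natPart (orderOf g) σ) *
    (((orderOf g / natPart (orderOf g) σ : ℕ) : ZMod (natPart (orderOf g) σ))⁻¹.val))

/-- The (unique, for `N` cyclic) Hall `σ`-subgroup of a subgroup `N`. -/
def hallOf (N : Subgroup G) (σ : Set ℕ) : Subgroup G :=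
  Subgroup.closure {x : G | x ∈ N ∧ orderOf x ∣ natPart (Nat.card N) σ}

/-- `R^G = T_G(G'_{π'})`, realized as a subgroup of `(ℤ/dℤ)ˣ`. -/
def ROf (G : Type*) [Group G] (d : ℕ) : Subgroup (ZMod d)ˣ :=
  TGmod (hallOf (commutator G) (piSet' G)) d

/-- The least `l > 0` with `x ^ (t ^ l) = x` (and `0` if there is none). -/
def expPeriod {M : Type*} [Monoid M] (t : ℕ) (x : M) : ℕ :=
  Function.minimalPeriod (fun z => z ^ t) x

theorem iterate_pow_const {M : Type*} [Monoid M] (t l : ℕ) (x : M) :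
    (fun z : M => z ^ t)^[l] x = x ^ (t ^ l) := by
  induction l with
  | zero => simp
  | succ l ih => rw [Function.iterate_succ_apply', ih, ← pow_mul, pow_succ]

theorem expPeriod_dvd_iff {M : Type*} [Monoid M] {t l : ℕ} {x : M} :
    expPeriod t x ∣ l ↔ x ^ (t ^ l) = x := by
  rw [expPeriod, ← Function.isPeriodicPt_iff_minimalPeriod_dvd, Function.IsPeriodicPt,
    Function.IsFixedPt, iterate_pow_const]

theorem pow_pow_expPeriod {M : Type*} [Monoid M] (t : ℕ) (x : M) :
    x ^ (t ^ expPeriod t x) = x := expPeriod_dvd_iff.1 dvd_rfl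

theorem pow_pow_mod_expPeriod {M : Type*} [Monoid M] (t l : ℕ) (x : M) :
    x ^ (t ^ (l % expPeriod t x)) = x ^ (t ^ l) := by
  rw [← iterate_pow_const, ← iterate_pow_const, expPeriod, Function.iterate_mod_minimalPeriod_eq]

theorem expPeriod_pow_dvd {M : Type*} [Monoid M] (t i : ℕ) (x : M) :
    expPeriod t (x ^ i) ∣ expPeriod t x := by
  rw [expPeriod_dvd_iff, ← pow_mul, mul_comm, pow_mul, pow_pow_expPeriod]

theorem pow_pow_injOn {M : Type*} [Monoid M] {t : ℕ} {x : M} :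
    Set.InjOn (fun l => x ^ (t ^ l)) (Set.Iio (expPeriod t x)) := by
  have := Function.iterate_injOn_Iio_minimalPeriod (f := fun z : M => z ^ t) (x := x)
  simp only [iterate_pow_const] at this
  exact this

/-- Generators and exponents of a metacyclic group `⟨a⟩⟨b⟩` with `⟨a⟩` normal. -/
structure MetaPres (G : Type*) [Group G] where
  a : G
  b : G
  m : ℕ
  n : ℕ
  c : ℕ
  t : ℕ
  m_pos : 0 < m
  n_pos : 0 < n
  order_a : orderOf a = m
  comm : a * b = b * a ^ t
  pow_n : b ^ n = a ^ c
  dvd_of_mem : ∀ j i : ℕ, b ^ j = a ^ i → n ∣ j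
  cover : ∀ g : G, ∃ i j : ℕ, g = a ^ i * b ^ j
  card : Nat.card G = m * n

namespace MetaPres

variable {G : Type*} [Group G] (P : MetaPres G)

theorem a_mul_pow (l : ℕ) : P.a * P.b ^ l = P.b ^ l * P.a ^ (P.t ^ l) := by
  induction l with
  | zero => simp
  | succ l ih =>
    have h : SemiconjBy P.b (P.a ^ P.t) P.a := P.comm.symm
    have h2 := h.pow_right (P.t ^ l)
    rw [pow_succ, ← mul_assoc, ih, mul_assoc, ← h2.eq, ← mul_assoc, ← pow_mul, pow_succ']

theorem pow_a_mul_pow (i l : ℕ) : P.a ^ i * P.b ^ l = P.b ^ l * P.a ^ (i * P.t ^ l) := by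
  have h : SemiconjBy (P.b ^ l) (P.a ^ (P.t ^ l)) P.a := (P.a_mul_pow l).symm
  rw [← (h.pow_right i).eq, ← pow_mul, mul_comm i]

theorem t_pow_n : P.t ^ P.n ≡ 1 [MOD P.m] := by
  have h := P.a_mul_pow P.n
  rw [P.pow_n, ← pow_succ', ← pow_add, pow_inj_mod, P.order_a] at h
  have h2 : P.c + 1 ≡ P.c + P.t ^ P.n [MOD P.m] := h
  exact (Nat.ModEq.add_left_cancel' _ h2).symm

theorem c_mul_t : P.c * P.t ≡ P.c [MOD P.m] := by
  have h := P.pow_a_mul_pow P.c 1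
  rw [← P.pow_n, pow_one, ← pow_succ, pow_succ', mul_left_cancel_iff, pow_one, P.pow_n,
    pow_inj_mod, P.order_a] at h
  exact Nat.ModEq.symm h

theorem t_coprime : P.t.Coprime P.m := by
  have h : Nat.gcd (P.t ^ P.n) P.m = 1 := by
    rw [P.t_pow_n.gcd_eq]; simp
  exact Nat.Coprime.coprime_dvd_left (dvd_pow_self _ P.n_pos.ne') h

end MetaPres

theorem pow_eq_pow_of_modEq_of_pow_eq_one {M : Type*} [Monoid M] {x : M} {m i j : ℕ}
    (hx : x ^ m = 1) (h : i ≡ j [MOD m]) : x ^ i = x ^ j := by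
  rw [← pow_mod_orderOf, ← pow_mod_orderOf x j, h.of_dvd (orderOf_dvd_of_pow_eq_one hx)]

namespace MetaPres

variable {G : Type*} [Group G] (P : MetaPres G)
variable {M : Type*} [Monoid M]

theorem expPeriod_dvd_n {x : M} (hx : x ^ P.m = 1) : expPeriod P.t x ∣ P.n := by
  rw [expPeriod_dvd_iff, pow_eq_pow_of_modEq_of_pow_eq_one hx P.t_pow_n, pow_one]

theorem expPeriod_pos {x : M} (hx : x ^ P.m = 1) : 0 < expPeriod P.t x :=
  Nat.pos_of_dvd_of_pos (P.expPeriod_dvd_n hx) P.n_pos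

section Rep

variable {L V : Type*} [Field L] [AddCommGroup V] [Module L V]

theorem rep_pow_apply {ρ : G →* Module.End L V} {g : G} {v : V} {x : L} (h : ρ g v = x • v) (i : ℕ) :
    ρ (g ^ i) v = x ^ i • v := by
  induction i with
  | zero => simp
  | succ i ih => rw [pow_succ', map_mul, Module.End.mul_apply, ih, map_smul, h, smul_smul, pow_succ]

variable {P}
variable {ρ : G →* Module.End L V} {v : V} {x y : L}

theorem rep_pow_mul_pow (ha : ρ P.a v = x • v) (i l : ℕ) :
    ρ (P.a ^ i) (ρ (P.b ^ l) v) = x ^ (i * P.t ^ l) • ρ (P.b ^ l) v := by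
  rw [← Module.End.mul_apply, ← map_mul, P.pow_a_mul_pow, map_mul, Module.End.mul_apply,
    rep_pow_apply ha, map_smul]

theorem rep_pow_b_apply {k : ℕ} (hb : ρ (P.b ^ k) v = y • v) (j : ℕ) :
    ρ (P.b ^ j) v = y ^ (j / k) • ρ (P.b ^ (j % k)) v := by
  conv_lhs => rw [← Nat.mod_add_div j k, pow_add, pow_mul, map_mul, Module.End.mul_apply,
    rep_pow_apply hb, map_smul]

theorem pow_m_eq_one_of_rep (hv : v ≠ 0) (ha : ρ P.a v = x • v) : x ^ P.m = 1 := by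
  have h := rep_pow_apply ha P.m
  rw [← P.order_a, pow_orderOf_eq_one, map_one, Module.End.one_apply] at h
  by_contra hne
  have h2 : (x ^ orderOf P.a - 1) • v = 0 := by rw [sub_smul, one_smul, ← h, sub_self]
  rcases smul_eq_zero.1 h2 with h3 | h3
  · rw [P.order_a] at h3
    exact hne (sub_eq_zero.1 h3)
  · exact hv h3

theorem rep_pow_b_ne_zero (hv : v ≠ 0) (g : G) : ρ g v ≠ 0 := by
  intro h
  apply hv
  have : ρ g⁻¹ (ρ g v) = v := by rw [← Module.End.mul_apply, ← map_mul]; simp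
  rw [← this, h, map_zero]

theorem linearIndependent_orbit (hv : v ≠ 0) (ha : ρ P.a v = x • v) :
    LinearIndependent L (fun l : Fin (expPeriod P.t x) => ρ (P.b ^ (l : ℕ)) v) := by
  refine Module.End.eigenvectors_linearIndependent' (ρ P.a)
    (fun l : Fin (expPeriod P.t x) => x ^ (P.t ^ (l : ℕ))) ?_ _ ?_
  · intro l l' h
    exact Fin.ext (pow_pow_injOn (x := x) (t := P.t) l.2 l'.2 h)
  · intro l
    rw [Module.End.hasEigenvector_iff, Module.End.mem_eigenspace_iff]
    refine ⟨?_, rep_pow_b_ne_zero hv _⟩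
    simpa using rep_pow_mul_pow ha 1 l

theorem rep_apply_orbit (ha : ρ P.a v = x • v) {k : ℕ}
    (hb : ρ (P.b ^ k) v = y • v) (i j l : ℕ) :
    ρ (P.a ^ i * P.b ^ j) (ρ (P.b ^ l) v) =
      (x ^ (i * P.t ^ ((j + l) % k)) * y ^ ((j + l) / k)) • ρ (P.b ^ ((j + l) % k)) v := by
  rw [map_mul, Module.End.mul_apply, ← Module.End.mul_apply (ρ (P.b ^ j)), ← map_mul, ← pow_add,
    rep_pow_b_apply hb, map_smul, rep_pow_mul_pow ha, smul_smul, mul_comm]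

theorem trace_rep [FiniteDimensional L V] (hv : v ≠ 0) (ha : ρ P.a v = x • v)
    (hk : Module.finrank L V = expPeriod P.t x)
    (hb : ρ (P.b ^ expPeriod P.t x) v = y • v) (i j : ℕ) :
    LinearMap.trace L V (ρ (P.a ^ i * P.b ^ j)) =
      if expPeriod P.t x ∣ j then
        y ^ (j / expPeriod P.t x) * ∑ l ∈ Finset.range (expPeriod P.t x), x ^ (i * P.t ^ l)
      else 0 := by
  have hpos := P.expPeriod_pos (pow_m_eq_one_of_rep hv ha)
  set k := expPeriod P.t x with hkdef
  have : Nonempty (Fin k) := ⟨⟨0, hpos⟩⟩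
  have hli := linearIndependent_orbit hv ha
  rw [← hkdef] at hli
  let B := basisOfLinearIndependentOfCardEqFinrank hli (by simp [hk])
  have hB : ∀ l : Fin k, B l = ρ (P.b ^ (l : ℕ)) v := fun l => by simp [B]
  have key : ∀ l : Fin k, ρ (P.a ^ i * P.b ^ j) (B l) =
      (x ^ (i * P.t ^ ((j + l) % k)) * y ^ ((j + l) / k)) •
        B ⟨(j + l) % k, Nat.mod_lt _ hpos⟩ := fun l => by
    rw [hB, hB, rep_apply_orbit ha hb]
  rw [LinearMap.trace_eq_matrix_trace L B, Matrix.trace]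
  simp only [Matrix.diag_apply, LinearMap.toMatrix_apply, key, map_smul, Module.Basis.repr_self,
    Finsupp.smul_apply, Finsupp.single_apply, smul_eq_mul, Fin.ext_iff]
  split_ifs with hd
  · obtain ⟨q, rfl⟩ := hd
    rw [Finset.mul_sum, Finset.sum_range]
    refine Finset.sum_congr rfl fun l _ => ?_
    have h1 : (k * q + l) % k = l := by
      rw [Nat.mul_add_mod, Nat.mod_eq_of_lt l.2]
    have h2 : (k * q + l) / k = q := by
      rw [Nat.mul_add_div hpos, Nat.div_eq_of_lt l.2, add_zero]
    rw [h1, h2, Nat.mul_div_cancel_left _ hpos]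
    simp [mul_comm]
  · refine Finset.sum_eq_zero fun l _ => ?_
    rw [if_neg, mul_zero]
    intro h
    apply hd
    have h3 : j + l ≡ 0 + l [MOD k] := by
      rw [Nat.ModEq, h, zero_add, Nat.mod_eq_of_lt l.2]
    exact (Nat.modEq_zero_iff_dvd).1 (Nat.ModEq.add_right_cancel' _ h3)

end Rep

end MetaPres

/-- The characters of the `k`-dimensional irreducible representations of the ring `R` over the
field `L` whose values are fixed by the endomorphism `s` of `L`. -/
def irrChars {L : Type*} [Field L] (s : L →+* L) (k : ℕ) (R : Type*) [Ring R] : Set (R → L) :=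
  {f | (∃ ρ : R →+* Module.End L (Fin k → L),
      (∀ W : Submodule L (Fin k → L), (∀ r, ∀ w ∈ W, ρ r w ∈ W) → W = ⊥ ∨ W = ⊤) ∧
      ∀ r, f r = LinearMap.trace L _ (ρ r)) ∧ ∀ r, s (f r) = f r}

theorem irrChars_comp {L : Type*} [Field L] {s : L →+* L} {k : ℕ} {R S : Type*} [Ring R] [Ring S]
    (e : R ≃+* S) {f : S → L} (hf : f ∈ irrChars s k S) : f ∘ e ∈ irrChars s k R := by
  obtain ⟨⟨ρ, hρ, htr⟩, hs⟩ := hf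
  refine ⟨⟨ρ.comp e.toRingHom, fun W hW => hρ W fun r w hw => ?_, fun r => htr _⟩, fun r => hs _⟩
  simpa using hW (e.symm r) w hw

theorem ncard_irrChars_congr {L : Type*} [Field L] (s : L →+* L) (k : ℕ) {R S : Type*}
    [Ring R] [Ring S] (e : R ≃+* S) : (irrChars s k R).ncard = (irrChars s k S).ncard := by
  refine Set.ncard_congr (fun f _ => f ∘ e.symm) (fun f hf => irrChars_comp e.symm hf) ?_ ?_
  · intro f g _ _ h
    funext r
    simpa using congrFun h (e r)
  · intro f hf
    exact ⟨f ∘ e, irrChars_comp e hf, by funext r; simp⟩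

section

variable {L : Type*} [Field L] [CharZero L] {G : Type*} [Group G] {k : ℕ}

theorem map_mem_of_forall_of {V : Type*} [AddCommGroup V] [Module L V]
    {ρ : MonoidAlgebra ℚ G →+* Module.End L V} {W : Submodule L V}
    {w : V} (h : ∀ g, ρ (MonoidAlgebra.of ℚ G g) w ∈ W) (r : MonoidAlgebra ℚ G) :
    ρ r w ∈ W := by
  let _ : Module ℚ V := Module.compHom V (algebraMap ℚ L)
  have : IsScalarTower ℚ L V := ⟨fun a b v => by
    rw [Algebra.smul_def, mul_smul]; rfl⟩
  induction r using MonoidAlgebra.induction_on with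
  | of g => exact h g
  | add f g hf hg => rw [map_add]; exact W.add_mem hf hg
  | smul q f hf =>
    rw [map_rat_smul, LinearMap.smul_apply]
    exact W.smul_of_tower_mem q hf

theorem trace_eq_of_forall_of
    {f : MonoidAlgebra ℚ G → L} {k' : ℕ} {f' : MonoidAlgebra ℚ G → L}
    {ρ : MonoidAlgebra ℚ G →+* Module.End L (Fin k → L)}
    {ρ' : MonoidAlgebra ℚ G →+* Module.End L (Fin k' → L)}
    (s : L →+* L)
    (hf : ∀ r, f r = LinearMap.trace L _ (ρ r)) (hf' : ∀ r, f' r = LinearMap.trace L _ (ρ' r))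
    (h : ∀ g, s (f (MonoidAlgebra.of ℚ G g)) = f' (MonoidAlgebra.of ℚ G g))
    (r : MonoidAlgebra ℚ G) :
    s (f r) = f' r := by
  induction r using MonoidAlgebra.induction_on with
  | of g => exact h g
  | add a b ha hb =>
    simp only [hf, hf', map_add] at ha hb ⊢
    rw [ha, hb]
  | smul q a ha =>
    simp only [hf, hf', map_rat_smul] at ha ⊢
    rw [ha]

end

namespace MetaPres

variable {G : Type*} [Group G] (P : MetaPres G)

variable {L : Type*} [Field L]

/-- The value at `a ^ i * b ^ j` of the irreducible character attached to `(x, y)`. -/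
def charVal (x y : L) (i j : ℕ) : L :=
  if expPeriod P.t x ∣ j then
    y ^ (j / expPeriod P.t x) * ∑ l ∈ Finset.range (expPeriod P.t x), x ^ (i * P.t ^ l)
  else 0

variable {P} in
theorem pow_y_eq {V : Type*} [AddCommGroup V] [Module L V] {ρ : G →* Module.End L V} {v : V}
    {x y : L} (hv : v ≠ 0) (ha : ρ P.a v = x • v)
    (hb : ρ (P.b ^ expPeriod P.t x) v = y • v) :
    y ^ (P.n / expPeriod P.t x) = x ^ P.c := by
  have h1 := rep_pow_apply hb (P.n / expPeriod P.t x)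
  rw [← pow_mul, Nat.mul_div_cancel' (P.expPeriod_dvd_n (pow_m_eq_one_of_rep hv ha)), P.pow_n,
    rep_pow_apply ha] at h1
  exact (smul_left_injective L hv h1).symm

theorem exists_weight [IsAlgClosed L] {V : Type*} [AddCommGroup V] [Module L V]
    [FiniteDimensional L V] [Nontrivial V] (ρ : G →* Module.End L V) :
    ∃ (x y : L) (v : V), v ≠ 0 ∧ ρ P.a v = x • v ∧ ρ (P.b ^ expPeriod P.t x) v = y • v := by
  obtain ⟨x, hx⟩ := Module.End.exists_eigenvalue (ρ P.a)
  have : Nontrivial ((ρ P.a).eigenspace x) := Submodule.nontrivial_iff_ne_bot.2 hx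
  have hstab : ∀ w ∈ (ρ P.a).eigenspace x,
      ρ (P.b ^ expPeriod P.t x) w ∈ (ρ P.a).eigenspace x := by
    intro w hw
    rw [Module.End.mem_eigenspace_iff] at hw ⊢
    have := rep_pow_mul_pow hw 1 (expPeriod P.t x)
    rwa [pow_one, one_mul, pow_pow_expPeriod] at this
  obtain ⟨y, hy⟩ := Module.End.exists_eigenvalue
    ((ρ (P.b ^ expPeriod P.t x)).restrict hstab)
  obtain ⟨w, hw⟩ := hy.exists_hasEigenvector
  refine ⟨x, y, w, ?_, Module.End.mem_eigenspace_iff.1 w.2, ?_⟩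
  · simpa using hw.2
  · simpa using congrArg Subtype.val hw.apply_eq_smul

theorem exists_of_mem_irrChars [IsAlgClosed L] [CharZero L] {k : ℕ} (hk : 0 < k)
    {ρ : MonoidAlgebra ℚ G →+* Module.End L (Fin k → L)}
    (hρ : ∀ W : Submodule L (Fin k → L), (∀ r, ∀ w ∈ W, ρ r w ∈ W) → W = ⊥ ∨ W = ⊤) :
    ∃ x y : L, x ^ P.m = 1 ∧ expPeriod P.t x = k ∧ y ^ (P.n / k) = x ^ P.c ∧
      ∀ i j, LinearMap.trace L _ (ρ (MonoidAlgebra.of ℚ G (P.a ^ i * P.b ^ j))) =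
        P.charVal x y i j := by
  have : Nonempty (Fin k) := ⟨⟨0, hk⟩⟩
  let ρ' : G →* Module.End L (Fin k → L) := (ρ : _ →* _).comp (MonoidAlgebra.of ℚ G)
  obtain ⟨x, y, v, hv, ha, hb⟩ := P.exists_weight ρ'
  have hx := pow_m_eq_one_of_rep hv ha
  have hpos := P.expPeriod_pos hx
  have hli := linearIndependent_orbit hv ha
  set W := Submodule.span L
    (Set.range fun l : Fin (expPeriod P.t x) => ρ' (P.b ^ (l : ℕ)) v) with hW
  have hstab : ∀ g, ∀ w ∈ W, ρ' g w ∈ W := by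
    intro g w hw
    obtain ⟨i, j, rfl⟩ := P.cover g
    have hle : W ≤ W.comap (ρ' (P.a ^ i * P.b ^ j)) := by
      rw [hW, Submodule.span_le]
      rintro _ ⟨l, rfl⟩
      rw [SetLike.mem_coe, Submodule.mem_comap, rep_apply_orbit ha hb]
      exact Submodule.smul_mem _ _
        (Submodule.subset_span ⟨⟨(j + l) % expPeriod P.t x, Nat.mod_lt _ hpos⟩, rfl⟩)
    exact hle hw
  have htop : W = ⊤ := by
    refine (hρ W fun r w hw => map_mem_of_forall_of (fun g => hstab g w hw) r).resolve_left ?_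
    intro hbot
    have : ρ' (P.b ^ 0) v ∈ W := Submodule.subset_span ⟨⟨0, hpos⟩, rfl⟩
    rw [hbot, Submodule.mem_bot] at this
    exact rep_pow_b_ne_zero hv _ this
  have hcard : k = expPeriod P.t x := by
    have := finrank_span_eq_card hli
    rw [← hW, htop, finrank_top] at this
    simpa using this
  refine ⟨x, y, hx, hcard.symm, ?_, ?_⟩
  · rw [← pow_y_eq hv ha hb, ← hcard]
  · intro i j
    exact trace_rep (ρ := ρ') hv ha (by simpa using hcard) hb i j

end MetaPres

namespace MetaPres

variable {G : Type*} [Group G] {P : MetaPres G} {L : Type*} [Field L]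

theorem eq_top_of_stable [IsAlgClosed L] {V : Type*} [AddCommGroup V] [Module L V]
    [FiniteDimensional L V] {ρ : G →* Module.End L V} {v : V} {x : L} (hv : v ≠ 0)
    (ha : ρ P.a v = x • v) (hk : Module.finrank L V = expPeriod P.t x)
    {W : Submodule L V} (hW : ∀ g, ∀ w ∈ W, ρ g w ∈ W) (hne : W ≠ ⊥) : W = ⊤ := by
  have hpos := P.expPeriod_pos (pow_m_eq_one_of_rep hv ha)
  have hli := linearIndependent_orbit hv ha
  set k := expPeriod P.t x with hkdef
  have : Nonempty (Fin k) := ⟨⟨0, hpos⟩⟩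
  let B := basisOfLinearIndependentOfCardEqFinrank hli (by simp [hk])
  have hB : ∀ l : Fin k, B l = ρ (P.b ^ (l : ℕ)) v := fun l => by simp [B]
  have hBa : ∀ l : Fin k, ρ P.a (B l) = x ^ (P.t ^ (l : ℕ)) • B l := fun l => by
    rw [hB]
    simpa using rep_pow_mul_pow ha 1 l
  have : Nontrivial W := Submodule.nontrivial_iff_ne_bot.2 hne
  obtain ⟨z, hz⟩ := Module.End.exists_eigenvalue ((ρ P.a).restrict (hW P.a))
  obtain ⟨⟨w, hwW⟩, hw⟩ := hz.exists_hasEigenvector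
  have hw0 : w ≠ 0 := by simpa using hw.2
  have hwz : ρ P.a w = z • w := by simpa using congrArg Subtype.val hw.apply_eq_smul
  have hcoef : ∀ l, B.repr w l * x ^ (P.t ^ (l : ℕ)) = z * B.repr w l := by
    intro l
    have h1 := congrArg (fun u => B.repr u l) hwz
    have h2 : ρ P.a w = ∑ i, (B.repr w i * x ^ (P.t ^ (i : ℕ))) • B i := by
      conv_lhs => rw [← B.sum_repr w]
      simp only [map_sum, map_smul, hBa, smul_smul]
    simp only [h2, map_smul, Finsupp.smul_apply, smul_eq_mul, B.repr_sum_self] at h1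
    exact h1
  obtain ⟨l, hl⟩ : ∃ l, B.repr w l ≠ 0 := by
    by_contra! h
    exact hw0 (B.ext_elem (by simpa using h))
  have hzl : z = x ^ (P.t ^ (l : ℕ)) := by
    have := hcoef l
    rw [mul_comm] at this
    exact (mul_right_cancel₀ hl this).symm
  have hother : ∀ l', l' ≠ l → B.repr w l' = 0 := by
    intro l' hl'
    by_contra hc
    have := hcoef l'
    rw [mul_comm] at this
    have h3 := (mul_right_cancel₀ hc this).trans hzl
    exact hl' (Fin.ext (pow_pow_injOn (x := x) (t := P.t) l'.2 l.2 h3))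
  have hwB : w = B.repr w l • B l := by
    conv_lhs => rw [← B.sum_repr w]
    exact Finset.sum_eq_single l (fun l' _ h => by rw [hother l' h, zero_smul]) (by simp)
  have hBl : B l ∈ W := by
    rw [hwB] at hwW
    exact (W.smul_mem_iff hl).1 hwW
  have hvW : v ∈ W := by
    have := hW (P.b ^ (l : ℕ))⁻¹ _ hBl
    rw [hB, ← Module.End.mul_apply, ← map_mul] at this
    simpa using this
  rw [eq_top_iff, ← B.span_eq, Submodule.span_le]
  rintro _ ⟨i, rfl⟩
  rw [hB]
  exact hW _ _ hvW

theorem exists_rep_of_weight {V : Type*} [AddCommGroup V] [Module L V]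
    {ρ : G →* Module.End L V} {v : V} {x y : L} (hv : v ≠ 0) (ha : ρ P.a v = x • v)
    (hb : ρ (P.b ^ expPeriod P.t x) v = y • v) :
    ∃ (ρ' : G →* Module.End L (Fin (expPeriod P.t x) → L)) (v' : Fin (expPeriod P.t x) → L),
      v' ≠ 0 ∧ ρ' P.a v' = x • v' ∧ ρ' (P.b ^ expPeriod P.t x) v' = y • v' := by
  have hpos := P.expPeriod_pos (pow_m_eq_one_of_rep hv ha)
  have hli := linearIndependent_orbit hv ha
  let ι := Fintype.linearCombination L
    (fun l : Fin (expPeriod P.t x) => ρ (P.b ^ (l : ℕ)) v)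
  have hι : Function.Injective ι := hli.fintypeLinearCombination_injective
  obtain ⟨p, hp⟩ := ι.exists_leftInverse_of_injective (LinearMap.ker_eq_bot.2 hι)
  have hp' : ∀ u, p (ι u) = u := fun u => LinearMap.congr_fun hp u
  have hι0 : ∀ l, ι (Pi.single l 1) = ρ (P.b ^ (l : ℕ)) v := fun l => by
    simp [ι, Fintype.linearCombination_apply_single]
  have hrange : ∀ g u, ∃ u', ρ g (ι u) = ι u' := by
    intro g u
    have hle : LinearMap.range ι ≤ (LinearMap.range ι).comap (ρ g) := by
      rw [Fintype.range_linearCombination, Submodule.span_le]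
      rintro _ ⟨l, rfl⟩
      obtain ⟨i, j, rfl⟩ := P.cover g
      rw [SetLike.mem_coe, Submodule.mem_comap, rep_apply_orbit ha hb]
      exact Submodule.smul_mem _ _
        (Submodule.subset_span ⟨⟨(j + l) % expPeriod P.t x, Nat.mod_lt _ hpos⟩, rfl⟩)
    obtain ⟨u', hu'⟩ := hle (LinearMap.mem_range_self ι u)
    exact ⟨u', hu'.symm⟩
  have hcomm : ∀ g u, ι (p (ρ g (ι u))) = ρ g (ι u) := by
    intro g u
    obtain ⟨u', hu'⟩ := hrange g u
    rw [hu', hp']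
  let ρ' : G →* Module.End L (Fin (expPeriod P.t x) → L) :=
    { toFun := fun g => p ∘ₗ ρ g ∘ₗ ι
      map_one' := by
        refine LinearMap.ext fun u => ?_
        simp [hp']
      map_mul' := fun g h => by
        refine LinearMap.ext fun u => ?_
        simp [hcomm] }
  have hρ' : ∀ g u, ρ' g u = p (ρ g (ι u)) := fun g u => rfl
  have hv0 : ι (Pi.single ⟨0, hpos⟩ 1) = v := by simpa using hι0 ⟨0, hpos⟩
  refine ⟨ρ', Pi.single ⟨0, hpos⟩ 1, by simp, ?_, ?_⟩
  · rw [hρ', hv0, ha, map_smul, ← hv0, hp']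
  · rw [hρ', hv0, hb, map_smul, ← hv0, hp']

variable (P) in
theorem weight_well_defined {x y : L} (hx : x ^ P.m = 1)
    (hy : y ^ (P.n / expPeriod P.t x) = x ^ P.c) {i j i' j' : ℕ}
    (h : P.b ^ (expPeriod P.t x * j) * P.a ^ i = P.b ^ (expPeriod P.t x * j') * P.a ^ i') :
    y ^ j * x ^ i = y ^ j' * x ^ i' := by
  wlog hle : j ≤ j' generalizing i j i' j'
  · exact (this h.symm (by omega)).symm
  set k := expPeriod P.t x
  have hkn : k ∣ P.n := P.expPeriod_dvd_n hx
  have hkpos : 0 < k := P.expPeriod_pos hx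
  obtain ⟨r, rfl⟩ := Nat.exists_eq_add_of_le hle
  rw [mul_add, pow_add, mul_assoc, mul_left_cancel_iff] at h
  have h1 : P.b ^ (k * r) = P.a ^ (i + (P.m - 1) * i') := by
    rw [pow_add, h, mul_assoc, ← pow_add]
    have : i' + (P.m - 1) * i' = P.m * i' := by
      have := P.m_pos
      obtain ⟨q, hq⟩ : ∃ q, P.m = q + 1 := ⟨P.m - 1, by omega⟩
      rw [hq]; simp; ring
    rw [this, ← P.order_a, pow_mul P.a, pow_orderOf_eq_one, one_pow, mul_one]
  have h2 : P.n ∣ k * r := P.dvd_of_mem _ _ h1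
  obtain ⟨q, hq⟩ := hkn
  rw [hq] at h2
  obtain ⟨e, rfl⟩ := (Nat.mul_dvd_mul_iff_left hkpos).1 h2
  have hnk : P.n / k = q := by rw [hq, Nat.mul_div_cancel_left _ hkpos]
  rw [hnk] at hy
  have h3 : P.a ^ i = P.a ^ (P.c * e + i') := by
    rw [h, ← mul_assoc k, ← hq, pow_mul, P.pow_n, ← pow_mul, pow_add]
  rw [pow_inj_mod, P.order_a] at h3
  rw [pow_add, pow_mul, hy, pow_eq_pow_of_modEq_of_pow_eq_one hx h3, pow_add, pow_mul, mul_assoc]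

variable (P) in
theorem exists_weight_function [Finite G] {x y : L} (hx : x ^ P.m = 1)
    (hy : y ^ (P.n / expPeriod P.t x) = x ^ P.c) :
    ∃ f : G → L, f 1 = 1 ∧ (∀ g, f (g * P.a) = x * f g) ∧
      ∀ g, f (g * P.b ^ expPeriod P.t x) = y * f g := by
  set k := expPeriod P.t x with hk
  let K : G → Prop := fun g => ∃ i j, g = P.b ^ (k * j) * P.a ^ i
  let f : G → L := fun g => if h : K g then y ^ h.choose_spec.choose * x ^ h.choose else 0
  have hf : ∀ i j, f (P.b ^ (k * j) * P.a ^ i) = y ^ j * x ^ i := by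
    intro i j
    have h : K (P.b ^ (k * j) * P.a ^ i) := ⟨i, j, rfl⟩
    simp only [f, dif_pos h]
    exact P.weight_well_defined hx hy h.choose_spec.choose_spec.symm
  have hf0 : ∀ g, ¬ K g → f g = 0 := fun g h => dif_neg h
  have hKa : ∀ g, K g → K (g * P.a) := by
    rintro _ ⟨i, j, rfl⟩
    exact ⟨i + 1, j, by rw [pow_succ, mul_assoc]⟩
  have hKb' : ∀ i j, P.b ^ (k * j) * P.a ^ i * P.b ^ k =
      P.b ^ (k * (j + 1)) * P.a ^ (i * P.t ^ k) := by
    intro i j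
    rw [mul_assoc, P.pow_a_mul_pow, ← mul_assoc, ← pow_add, mul_add, mul_one]
  have hKb : ∀ g, K g → K (g * P.b ^ k) := by
    rintro _ ⟨i, j, rfl⟩
    exact ⟨_, _, hKb' i j⟩
  have hinv : ∀ u : G, (∀ g, K g → K (g * u)) → ∀ g, K (g * u) → K g := by
    intro u hu g hg
    have : ∀ l : ℕ, K (g * u * u ^ l) := by
      intro l
      induction l with
      | zero => simpa using hg
      | succ l ih => rw [pow_succ, ← mul_assoc]; exact hu _ ih
    have h1 := this (orderOf u - 1)
    rwa [mul_assoc, ← pow_succ', Nat.sub_add_cancel (orderOf_pos u), pow_orderOf_eq_one,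
      mul_one] at h1
  refine ⟨f, by simpa using hf 0 0, fun g => ?_, fun g => ?_⟩
  · by_cases hg : K g
    · obtain ⟨i, j, rfl⟩ := hg
      rw [mul_assoc, ← pow_succ, hf, hf]
      ring
    · rw [hf0 _ hg, hf0 _ fun h => hg (hinv _ hKa _ h), mul_zero]
  · by_cases hg : K g
    · obtain ⟨i, j, rfl⟩ := hg
      rw [hKb', hf, hf, mul_comm i, pow_mul, hk, pow_pow_expPeriod]
      ring
    · rw [hf0 _ hg, hf0 _ fun h => hg (hinv _ hKb _ h), mul_zero]

variable (P) in
theorem exists_irreducible [IsAlgClosed L] [CharZero L] [Finite G] {x y : L} (hx : x ^ P.m = 1)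
    (hy : y ^ (P.n / expPeriod P.t x) = x ^ P.c) :
    ∃ ρ : MonoidAlgebra ℚ G →+* Module.End L (Fin (expPeriod P.t x) → L),
      (∀ W : Submodule L (Fin (expPeriod P.t x) → L), (∀ r, ∀ w ∈ W, ρ r w ∈ W) →
        W = ⊥ ∨ W = ⊤) ∧
      ∀ i j, LinearMap.trace L _ (ρ (MonoidAlgebra.of ℚ G (P.a ^ i * P.b ^ j))) =
        P.charVal x y i j := by
  obtain ⟨f, hf1, hfa, hfb⟩ := P.exists_weight_function hx hy
  let ρ₀ : G →* Module.End L (G → L) :=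
    { toFun := fun g => LinearMap.funLeft L L (fun u => u * g)
      map_one' := by
        refine LinearMap.ext fun u => ?_
        funext h
        simp [LinearMap.funLeft_apply]
      map_mul' := fun g h => by
        refine LinearMap.ext fun u => ?_
        funext u'
        simp [LinearMap.funLeft_apply, mul_assoc] }
  have hf0 : f ≠ 0 := fun h => by simp [h] at hf1
  obtain ⟨ρ', v, hv, ha, hb⟩ := exists_rep_of_weight (P := P) (ρ := ρ₀) (v := f) (x := x) (y := y)
    hf0 (by funext g; simpa [ρ₀, LinearMap.funLeft_apply] using hfa g)
    (by funext g; simpa [ρ₀, LinearMap.funLeft_apply] using hfb g)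
  let ρ : MonoidAlgebra ℚ G →ₐ[ℚ] Module.End L (Fin (expPeriod P.t x) → L) :=
    MonoidAlgebra.lift ℚ _ G ρ'
  have hρ : ∀ g, ρ (MonoidAlgebra.of ℚ G g) = ρ' g := fun g => by
    simp [ρ]
  refine ⟨ρ, fun W hW => ?_, fun i j => ?_⟩
  · by_cases hne : W = ⊥
    · exact Or.inl hne
    · refine Or.inr (eq_top_of_stable hv ha (by simp) (fun g w hw => ?_) hne)
      rw [← hρ]
      exact hW _ _ hw
  · have := trace_rep hv ha (by simp) hb i j
    rw [← hρ] at this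
    exact this

end MetaPres

theorem expPeriod_pow_eq {M : Type*} [Monoid M] {t i j : ℕ} {x : M} (h : (x ^ i) ^ j = x) :
    expPeriod t (x ^ i) = expPeriod t x := by
  refine Nat.dvd_antisymm (expPeriod_pow_dvd t i x) ?_
  conv_lhs => rw [← h]
  exact expPeriod_pow_dvd t j _

theorem pow_pow_pow_sub {M : Type*} [Monoid M] {t : ℕ} {x : M} (hx : 0 < expPeriod t x) (l : ℕ) :
    (x ^ (t ^ l)) ^ (t ^ (expPeriod t x * l - l)) = x := by
  rw [← pow_mul, ← pow_add, Nat.add_sub_cancel' (Nat.le_mul_of_pos_left l hx)]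
  exact expPeriod_dvd_iff.1 (dvd_mul_right _ _)

theorem expPeriod_pow_pow {M : Type*} [Monoid M] {t : ℕ} {x : M} (hx : 0 < expPeriod t x) (l : ℕ) :
    expPeriod t (x ^ (t ^ l)) = expPeriod t x :=
  expPeriod_pow_eq (pow_pow_pow_sub hx l)

theorem exists_eq_of_sum_pow_eq {L : Type*} [Field L] {k : ℕ} {f g : ℕ → L} (hk : 0 < k)
    (hg : Set.InjOn g (Set.Iio k))
    (h : ∀ i, ∑ l ∈ Finset.range k, f l ^ i = ∑ l ∈ Finset.range k, g l ^ i) :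
    ∃ l < k, g 0 = f l := by
  by_contra! hne
  have hq : ∀ q : Polynomial L,
      ∑ l ∈ Finset.range k, q.eval (f l) = ∑ l ∈ Finset.range k, q.eval (g l) := by
    intro q
    simp only [Polynomial.eval_eq_sum_range]
    rw [Finset.sum_comm, Finset.sum_comm (s := Finset.range k)]
    simp only [← Finset.mul_sum, h]
  let q₁ : Polynomial L := ∏ l ∈ Finset.range k, (Polynomial.X - Polynomial.C (f l))
  let q₂ : Polynomial L := ∏ l ∈ Finset.range k \ {0}, (Polynomial.X - Polynomial.C (g l))
  have h1 : ∀ l ∈ Finset.range k, (q₁ * q₂).eval (f l) = 0 := by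
    intro l hl
    rw [Polynomial.eval_mul, Polynomial.eval_prod, Finset.prod_eq_zero hl (by simp), zero_mul]
  have h2 : ∀ l ∈ Finset.range k, l ≠ 0 → (q₁ * q₂).eval (g l) = 0 := by
    intro l hl h0
    have hl' : l ∈ Finset.range k \ {0} := by simp [h0] at hl ⊢; exact hl
    rw [Polynomial.eval_mul, Polynomial.eval_prod (Finset.range k \ {0}),
      Finset.prod_eq_zero hl' (by simp), mul_zero]
  have h3 := hq (q₁ * q₂)
  rw [Finset.sum_eq_zero h1, Finset.sum_eq_single 0 h2 (by simp [hk.ne']), Polynomial.eval_mul,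
    Polynomial.eval_prod, Polynomial.eval_prod, eq_comm, mul_eq_zero, Finset.prod_eq_zero_iff,
    Finset.prod_eq_zero_iff] at h3
  rcases h3 with ⟨l, hl, h4⟩ | ⟨l, hl, h4⟩
  · simp only [Polynomial.eval_sub, Polynomial.eval_X, Polynomial.eval_C] at h4
    exact hne l (Finset.mem_range.1 hl) (sub_eq_zero.1 h4)
  · simp only [Polynomial.eval_sub, Polynomial.eval_X, Polynomial.eval_C, Finset.mem_sdiff,
      Finset.mem_range, Finset.mem_singleton] at h4 hl
    exact hl.2 (hg hl.1 hk (sub_eq_zero.1 h4).symm)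

namespace MetaPres

variable {G : Type*} [Group G] (P : MetaPres G) {L : Type*} [Field L]

theorem charVal_pow_pow {x : L} (hx : 0 < expPeriod P.t x) (y : L) (l i j : ℕ) :
    P.charVal (x ^ (P.t ^ l)) y i j = P.charVal x y i j := by
  induction l with
  | zero => simp
  | succ l ih =>
    rw [← ih, charVal, charVal, expPeriod_pow_pow hx, expPeriod_pow_pow hx]
    congr 2
    have h1 : ∀ r, (x ^ P.t ^ (l + 1)) ^ (i * P.t ^ r) =
        (fun r => (x ^ P.t ^ l) ^ (i * P.t ^ r)) (r + 1) := by
      intro r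
      simp only [← pow_mul]
      congr 1
      ring
    simp only [h1]
    have h2 := Finset.sum_range_succ (fun r => (x ^ P.t ^ l) ^ (i * P.t ^ r)) (expPeriod P.t x)
    rw [Finset.sum_range_succ'] at h2
    have h3 : (x ^ P.t ^ l) ^ (i * P.t ^ expPeriod P.t x) = (x ^ P.t ^ l) ^ (i * P.t ^ 0) := by
      have := pow_pow_expPeriod P.t (x ^ P.t ^ l)
      rw [expPeriod_pow_pow hx] at this
      rw [mul_comm i, pow_mul, this, pow_zero, mul_one]
    rw [h3] at h2
    exact add_right_cancel h2

theorem eq_of_charVal_eq [CharZero L] {x y x' y' : L} (hx : 0 < expPeriod P.t x)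
    (hk : expPeriod P.t x' = expPeriod P.t x)
    (h : ∀ i j, P.charVal x y i j = P.charVal x' y' i j) :
    (∃ l < expPeriod P.t x, x' = x ^ (P.t ^ l)) ∧ y' = y := by
  constructor
  · have := exists_eq_of_sum_pow_eq (f := fun l => x ^ (P.t ^ l)) (g := fun l => x' ^ (P.t ^ l)) hx
      (by rw [← hk]; exact pow_pow_injOn) (fun i => by
        have := h i 0
        simp only [charVal, hk, dvd_zero, if_true, Nat.zero_div, pow_zero, one_mul] at this
        simpa only [← pow_mul, mul_comm i] using this)
    simpa using this
  · have := h 0 (expPeriod P.t x)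
    simp only [charVal, hk, dvd_refl, if_true, Nat.div_self hx, pow_one, zero_mul, pow_zero,
      Finset.sum_const, Finset.card_range, nsmul_eq_mul, mul_one] at this
    exact (mul_right_cancel₀ (Nat.cast_ne_zero.2 hx.ne') this).symm

theorem map_charVal {σ : L →+* L} {s u : ℕ} {x y : L} (hx : σ x = x ^ s) (hy : σ y = y ^ s)
    (hu : (x ^ s) ^ u = x) (i j : ℕ) :
    σ (P.charVal x y i j) = P.charVal (x ^ s) (y ^ s) i j := by
  rw [charVal, charVal, expPeriod_pow_eq hu]
  split_ifs <;> simp [hx, hy]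

theorem pow_c_mul_pow {M : Type*} [Monoid M] {x : M} (hx : x ^ P.m = 1) (l : ℕ) :
    (x ^ (P.t ^ l)) ^ P.c = x ^ P.c := by
  rw [← pow_mul, mul_comm]
  refine pow_eq_pow_of_modEq_of_pow_eq_one hx ?_
  induction l with
  | zero => simp [Nat.ModEq.refl]
  | succ l ih => 
    rw [pow_succ, ← mul_assoc]
    exact (ih.mul_right _).trans P.c_mul_t

end MetaPres

theorem gcd_mul_of_coprime {k q w w' : ℕ} (hw : w.Coprime w') (h : k * q ∣ w * w')
    (h0 : 0 < w * w') :
    Nat.gcd (k * q) w = Nat.gcd k w * Nat.gcd q w := by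
  have h1 : ∀ e, e ∣ w * w' → e = Nat.gcd e w * Nat.gcd e w' := fun e he => by
    rw [← hw.gcd_mul, Nat.gcd_eq_left he]
  have hk := h1 k (dvd_of_mul_right_dvd h)
  have hq := h1 q (dvd_of_mul_left_dvd h)
  have hkq := h1 _ h
  have hpos := Nat.pos_of_dvd_of_pos h h0
  have d1 := Nat.le_of_dvd (Nat.mul_pos
    (Nat.gcd_pos_of_pos_left w (Nat.pos_of_mul_pos_right hpos))
    (Nat.gcd_pos_of_pos_left w (Nat.pos_of_mul_pos_left hpos))) (Nat.gcd_mul_left_dvd_mul_gcd w k q)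
  have d2 := Nat.le_of_dvd (Nat.mul_pos
    (Nat.gcd_pos_of_pos_left w' (Nat.pos_of_mul_pos_right hpos))
    (Nat.gcd_pos_of_pos_left w' (Nat.pos_of_mul_pos_left hpos)))
    (Nat.gcd_mul_left_dvd_mul_gcd w' k q)
  have hpos2 := Nat.gcd_pos_of_pos_left w' hpos
  have he : Nat.gcd (k * q) w * Nat.gcd (k * q) w' =
    (Nat.gcd k w * Nat.gcd q w) * (Nat.gcd k w' * Nat.gcd q w') := by
    rw [← hkq]
    conv_lhs => rw [hk, hq]
    ring
  refine le_antisymm d1 ?_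
  by_contra! hlt
  have := Nat.mul_lt_mul_of_lt_of_le hlt d2 (hpos2.trans_le d2)
  omega

theorem ncard_pow_eq {L : Type*} [Field L] [IsAlgClosed L] [CharZero L] {w w' q : ℕ} {z : L}
    (hw : w.Coprime w') (hq : 0 < q) (hw0 : 0 < w) (hz : z ^ w = 1) (hzq : ∀ y : L, y ^ q = z → y ^ (w * w') = 1) :
    {y : L | y ^ q = z ∧ y ^ w = 1}.ncard = Nat.gcd q w := by
  obtain ⟨y₁, hy₁⟩ := IsAlgClosed.exists_pow_nat_eq z hq
  obtain ⟨u, hu1, hu2⟩ := Nat.chineseRemainder hw 1 0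
  have hz0 : z ≠ 0 := by
    rintro rfl
    rw [zero_pow hw0.ne'] at hz
    exact zero_ne_one hz
  have hy0 : y₁ ^ u ≠ 0 := by
    refine pow_ne_zero _ ?_
    rintro rfl
    rw [zero_pow hq.ne'] at hy₁
    exact hz0 hy₁.symm
  have hyq : (y₁ ^ u) ^ q = z := by
    rw [pow_right_comm, hy₁, pow_eq_pow_of_modEq_of_pow_eq_one hz hu1, pow_one]
  have hyw : (y₁ ^ u) ^ w = 1 := by
    obtain ⟨e, rfl⟩ := (Nat.modEq_zero_iff_dvd).1 hu2
    rw [← pow_mul, mul_right_comm, mul_comm w', pow_mul, hzq _ hy₁, one_pow]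
  set g := Nat.gcd q w
  have hg : 0 < g := Nat.gcd_pos_of_pos_left _ hq
  have : NeZero (g : L) := ⟨Nat.cast_ne_zero.2 hg.ne'⟩
  have : NeZero g := ⟨hg.ne'⟩
  obtain ⟨ζ, hζ⟩ := HasEnoughRootsOfUnity.exists_primitiveRoot L g
  have hset : {y : L | y ^ q = z ∧ y ^ w = 1} =
      (fun o => y₁ ^ u * o) '' (Polynomial.nthRootsFinset g (1 : L) : Set L) := by
    ext y
    simp only [Set.mem_ofPred_eq, Set.mem_image, Finset.mem_coe, Polynomial.mem_nthRootsFinset hg]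
    constructor
    · rintro ⟨h1, h2⟩
      refine ⟨y / y₁ ^ u, pow_gcd_eq_one.2 ⟨?_, ?_⟩, mul_div_cancel₀ _ hy0⟩
      · rw [div_pow, h1, hyq, div_self hz0]
      · rw [div_pow, h2, hyw, div_one]
    · rintro ⟨o, ho, rfl⟩
      rw [pow_gcd_eq_one] at ho
      rw [mul_pow, mul_pow, ho.1, ho.2, hyq, hyw]
      simp
  rw [hset, Set.ncard_image_of_injective _ (mul_right_injective₀ hy0), Set.ncard_coe_finset,
    hζ.card_nthRootsFinset]

theorem ncard_eq_mul_of_fiber {α β : Type*} {A : Set α} {B : Set β} {f : α → β} {c : ℕ}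
    (hA : A.Finite) (hB : B.Finite) (hf : Set.MapsTo f A B)
    (h : ∀ b ∈ B, {a | a ∈ A ∧ f a = b}.ncard = c) : A.ncard = c * B.ncard := by
  lift A to Finset α using hA
  lift B to Finset β using hB
  rw [Set.ncard_coe_finset, Set.ncard_coe_finset, Finset.card_eq_sum_card_fiberwise hf, mul_comm,
    ← smul_eq_mul, ← Finset.sum_const]
  refine Finset.sum_congr rfl fun b hb => ?_
  rw [← h b hb, ← Set.ncard_coe_finset]
  congr 1
  ext a
  simp

theorem finite_setOf_pow_eq_one {L : Type*} [Field L] {N : ℕ} (hN : 0 < N) :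
    {x : L | x ^ N = 1}.Finite := by
  refine (Polynomial.nthRootsFinset N (1 : L)).finite_toSet.subset fun x hx => ?_
  simpa [Polynomial.mem_nthRootsFinset hN] using hx

theorem pow_eq_self_iff {L : Type*} [Field L] {y : L} {s N : ℕ} (hs : 0 < s) (hN : 0 < N)
    (hy : y ^ N = 1) : y ^ s = y ↔ y ^ Nat.gcd (s - 1) N = 1 := by
  have hy0 : y ≠ 0 := by
    rintro rfl
    rw [zero_pow hN.ne'] at hy
    exact zero_ne_one hy
  rw [pow_gcd_eq_one]
  obtain ⟨s, rfl⟩ := Nat.exists_eq_succ_of_ne_zero hs.ne'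
  constructor
  · intro h
    refine ⟨mul_right_cancel₀ hy0 ?_, hy⟩
    rw [one_mul, ← pow_succ]
    exact h
  · rintro ⟨h, -⟩
    rw [Nat.succ_sub_one] at h
    rw [pow_succ, h, one_mul]

theorem exists_pow_pow_eq_self {M : Type*} [Monoid M] {x : M} {s N : ℕ} (hs : s.Coprime N)
    (hx : x ^ N = 1) : ∃ u, (x ^ s) ^ u = x :=
  exists_pow_eq_self_of_coprime (hs.coprime_dvd_right (orderOf_dvd_of_pow_eq_one hx))

namespace MetaPres

variable {G : Type*} [Group G] (P : MetaPres G) {L : Type*} [Field L]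

/-- The `m`-th roots of unity of period `k` whose orbit is stable under raising to the `s`. -/
def stableRoots (L : Type*) [Field L] (s : ℕ) (D : ℕ → Prop) : Set L :=
  {x | x ^ P.m = 1 ∧ D (expPeriod P.t x) ∧ ∃ l, x ^ s = x ^ (P.t ^ l)}

theorem finite_stableRoots (s : ℕ) (D : ℕ → Prop) : (P.stableRoots L s D).Finite :=
  (finite_setOf_pow_eq_one P.m_pos).subset fun _ hx => hx.1

theorem pow_card_eq_one_of_pow {x y : L} (hx : x ^ P.m = 1) {k : ℕ} (hk : k ∣ P.n)
    (hy : y ^ (P.n / k) = x ^ P.c) : y ^ Nat.card G = 1 := by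
  obtain ⟨q, hq⟩ := hk
  rcases Nat.eq_zero_or_pos k with rfl | hk
  · have := P.n_pos
    simp at hq
    omega
  rw [hq, Nat.mul_div_cancel_left _ hk] at hy
  rw [P.card, hq, show P.m * (k * q) = q * (P.m * k) by ring, pow_mul, hy, pow_right_comm,
    pow_mul, hx, one_pow, one_pow]

theorem pow_card_eq_one {x : L} (hx : x ^ P.m = 1) : x ^ Nat.card G = 1 := by
  rw [P.card, pow_mul, hx, one_pow]

theorem card_pos {G : Type*} [Group G] (P : MetaPres G) : 0 < Nat.card G := by
  rw [P.card]
  exact Nat.mul_pos P.m_pos P.n_pos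

variable [IsAlgClosed L] [CharZero L] {σ : L →+* L} {s w w' k : ℕ}

theorem ncard_pairs (hs0 : 0 < s) (hw : w.Coprime w')
    (hN : Nat.card G = w * w') (hg : Nat.gcd (s - 1) (Nat.card G) = w) :
    {p : L × L | p.1 ∈ P.stableRoots L s (· = k) ∧ p.2 ^ (P.n / k) = p.1 ^ P.c ∧
      p.2 ^ s = p.2}.ncard = Nat.gcd (P.n / k) w * (P.stableRoots L s (· = k)).ncard := by
  have hNpos := MetaPres.card_pos P
  refine ncard_eq_mul_of_fiber (f := Prod.fst) ?_ (P.finite_stableRoots _ _) (fun p hp => hp.1) ?_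
  · refine (((finite_setOf_pow_eq_one hNpos).prod (finite_setOf_pow_eq_one hNpos))).subset ?_
    rintro ⟨x, y⟩ ⟨⟨hx, rfl, -⟩, hy, -⟩
    exact ⟨P.pow_card_eq_one hx, P.pow_card_eq_one_of_pow hx (P.expPeriod_dvd_n hx) hy⟩
  · rintro x ⟨hx, rfl, l, hl⟩
    have hkn := P.expPeriod_dvd_n hx
    have hkpos := P.expPeriod_pos hx
    have hz : (x ^ P.c) ^ w = 1 := by
      rw [← hg, ← pow_eq_self_iff hs0 hNpos (by rw [pow_right_comm, P.pow_card_eq_one hx, one_pow]),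
        pow_right_comm, hl, P.pow_c_mul_pow hx]
    rw [← ncard_pow_eq hw (Nat.div_pos (Nat.le_of_dvd P.n_pos hkn) hkpos) 
      (by rw [← hg]; exact Nat.gcd_pos_of_pos_right _ hNpos) hz
      (fun y hy => by rw [← hN]; exact P.pow_card_eq_one_of_pow hx hkn hy)]
    refine Set.ncard_congr (fun p _ => p.2) ?_ ?_ ?_
    · rintro ⟨x', y⟩ ⟨⟨-, h1, h2⟩, rfl⟩
      refine ⟨h1, ?_⟩
      rw [← hg, ← pow_eq_self_iff hs0 hNpos (P.pow_card_eq_one_of_pow hx hkn h1)]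
      exact h2
    · rintro ⟨x1, y1⟩ ⟨x2, y2⟩ ⟨-, rfl⟩ ⟨-, h⟩ h'
      exact Prod.ext h.symm h'
    · rintro y ⟨h1, h2⟩
      rw [← hg, ← pow_eq_self_iff hs0 hNpos (P.pow_card_eq_one_of_pow hx hkn h1)] at h2
      exact ⟨(x, y), ⟨⟨⟨hx, rfl, l, hl⟩, h1, h2⟩, rfl⟩, rfl⟩

variable [Finite G]

theorem mul_ncard_irrChars (hσ : ∀ z : L, z ^ Nat.card G = 1 → σ z = z ^ s) 
    (hcop : s.Coprime (Nat.card G)) (hk : 0 < k) :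
    {p : L × L | p.1 ∈ P.stableRoots L s (· = k) ∧ p.2 ^ (P.n / k) = p.1 ^ P.c ∧
      p.2 ^ s = p.2}.ncard = k * (irrChars σ k (MonoidAlgebra ℚ G)).ncard := by
  have hNpos := MetaPres.card_pos P
  set A := {p : L × L | p.1 ∈ P.stableRoots L s (· = k) ∧ p.2 ^ (P.n / k) = p.1 ^ P.c ∧
      p.2 ^ s = p.2} with hAdef
  have hA : A.Finite := by
    refine (((finite_setOf_pow_eq_one hNpos).prod (finite_setOf_pow_eq_one hNpos))).subset ?_
    rintro ⟨x, y⟩ ⟨⟨hx, rfl, -⟩, hy, -⟩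
    exact ⟨P.pow_card_eq_one hx, P.pow_card_eq_one_of_pow hx (P.expPeriod_dvd_n hx) hy⟩
  have hmap : ∀ p : L × L, p.1 ^ P.m = 1 → expPeriod P.t p.1 = k →
      p.2 ^ (P.n / k) = p.1 ^ P.c →
      ∀ i j, σ (P.charVal p.1 p.2 i j) = P.charVal (p.1 ^ s) (p.2 ^ s) i j := by
    rintro ⟨x, y⟩ hx rfl hy i j
    obtain ⟨u, hu⟩ := exists_pow_pow_eq_self hcop (P.pow_card_eq_one hx)
    exact map_charVal P (hσ _ (P.pow_card_eq_one hx))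
      (hσ _ (P.pow_card_eq_one_of_pow hx (P.expPeriod_dvd_n hx) hy)) hu i j
  have hex : ∀ p : L × L, p ∈ A → ∃ f ∈ irrChars σ k (MonoidAlgebra ℚ G), ∀ i j,
      f (MonoidAlgebra.of ℚ G (P.a ^ i * P.b ^ j)) = P.charVal p.1 p.2 i j := by
    rintro ⟨x, y⟩ ⟨⟨hx, hkx, l, hl⟩, hy, hys⟩
    have hm := hmap (x, y) hx hkx hy
    subst hkx
    obtain ⟨ρ, hρ, htr⟩ := P.exists_irreducible hx hy
    refine ⟨fun r => LinearMap.trace L _ (ρ r), ⟨⟨ρ, hρ, fun _ => rfl⟩, ?_⟩, htr⟩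
    refine trace_eq_of_forall_of σ (fun _ => rfl) (fun _ => rfl) fun g => ?_
    obtain ⟨i, j, rfl⟩ := P.cover g
    simp only at hl hys
    rw [htr, hm, hl, hys, P.charVal_pow_pow hk]
  choose! Φ hΦ hval using hex
  have hsurj : ∀ f ∈ irrChars σ k (MonoidAlgebra ℚ G), ∃ p ∈ A, Φ p = f := by
    rintro f ⟨⟨ρ, hρ, htr⟩, hfix⟩
    obtain ⟨x, y, hx, hkx, hy, hv⟩ := P.exists_of_mem_irrChars hk hρ
    have hm := hmap (x, y) hx hkx hy
    obtain ⟨u, hu⟩ := exists_pow_pow_eq_self hcop (P.pow_card_eq_one hx)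
    obtain ⟨⟨l, -, hl⟩, hys⟩ := P.eq_of_charVal_eq (x := x) (y := y) (x' := x ^ s) (y' := y ^ s)
      (hkx ▸ hk) (expPeriod_pow_eq hu) fun i j => by
        rw [← hm, ← hv, ← htr, hfix]
    have hp : (x, y) ∈ A := ⟨⟨hx, hkx, l, hl⟩, hy, hys⟩
    refine ⟨(x, y), hp, ?_⟩
    obtain ⟨⟨ρ', -, htr'⟩, -⟩ := hΦ _ hp
    funext r
    refine trace_eq_of_forall_of (RingHom.id L) htr' htr (fun g => ?_) r
    obtain ⟨i, j, rfl⟩ := P.cover g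
    rw [htr, hv, RingHom.id_apply, hval _ hp]
  have hB : (irrChars σ k (MonoidAlgebra ℚ G)).Finite :=
    (hA.image Φ).subset fun f hf => by
      obtain ⟨p, hp, h⟩ := hsurj f hf
      exact ⟨p, hp, h⟩
  refine ncard_eq_mul_of_fiber hA hB (fun p hp => hΦ p hp) fun f hf => ?_
  obtain ⟨⟨x, y⟩, hp, rfl⟩ := hsurj f hf
  have hset : {p | p ∈ A ∧ Φ p = Φ (x, y)} =
      (fun l => (x ^ (P.t ^ l), y)) '' Set.Iio k := by
    obtain ⟨⟨hx, hkx, l, hl⟩, hy, hys⟩ := id hp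
    simp only at hx hkx hl hy hys
    ext ⟨x', y'⟩
    simp only [Set.mem_ofPred_eq, Set.mem_image, Set.mem_Iio, Prod.mk.injEq]
    constructor
    · rintro ⟨hp', heq⟩
      obtain ⟨⟨l', hl', h1⟩, h2⟩ := P.eq_of_charVal_eq (x := x) (y := y) (x' := x') (y' := y')
        (hkx ▸ hk) (hp'.1.2.1.trans hkx.symm) fun i j => by
          rw [← hval _ hp, ← hval _ hp', heq]
      exact ⟨l', hkx ▸ hl', h1.symm, h2.symm⟩
    · rintro ⟨l', hl', rfl, rfl⟩
      have hp' : (x ^ P.t ^ l', y) ∈ A := by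
        refine ⟨⟨?_, ?_, l, ?_⟩, ?_, hys⟩
        · simp only
          rw [pow_right_comm, hx, one_pow]
        · simp only
          rw [expPeriod_pow_pow (hkx ▸ hk), hkx]
        · simp only
          rw [pow_right_comm, hl, pow_right_comm]
        · simp only
          rw [P.pow_c_mul_pow hx, hy]
      refine ⟨hp', ?_⟩
      obtain ⟨⟨ρ', -, htr'⟩, -⟩ := hΦ _ hp
      obtain ⟨⟨ρ, -, htr⟩, -⟩ := hΦ _ hp'
      funext r
      refine trace_eq_of_forall_of (RingHom.id L) htr htr' (fun g => ?_) r
      obtain ⟨i, j, rfl⟩ := P.cover g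
      rw [RingHom.id_apply, hval _ hp, hval _ hp', P.charVal_pow_pow (hkx ▸ hk)]
  rw [hset, Set.InjOn.ncard_image]
  · rw [← Nat.card_coe_set_eq]
    simp
  · intro l1 h1 l2 h2 h
    have hkx := hp.1.2.1
    exact pow_pow_injOn (x := x) (t := P.t) (hkx ▸ h1) (hkx ▸ h2) (Prod.mk.inj h).1

theorem gcd_mul_ncard_stableRoots (hσ : ∀ z : L, z ^ Nat.card G = 1 → σ z = z ^ s) (hs0 : 0 < s)
    (hcop : s.Coprime (Nat.card G)) (hw : w.Coprime w')
    (hN : Nat.card G = w * w') (hg : Nat.gcd (s - 1) (Nat.card G) = w) (D : ℕ → Prop) :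
    Nat.gcd P.n w * (P.stableRoots L s D).ncard =
      ∑ k ∈ (Finset.Icc 1 (Nat.card G)).filter D,
        Nat.gcd k w * (k * (irrChars σ k (MonoidAlgebra ℚ G)).ncard) := by
  have hNpos := MetaPres.card_pos P
  have hfin := P.finite_stableRoots (L := L) s
  have h1 : (P.stableRoots L s D).ncard =
      ∑ k ∈ (Finset.Icc 1 (Nat.card G)).filter D, (P.stableRoots L s (· = k)).ncard := by
    rw [Set.ncard_eq_toFinset_card _ (hfin D), Finset.card_eq_sum_card_fiberwise
      (f := fun x => expPeriod P.t x) (t := (Finset.Icc 1 (Nat.card G)).filter D)]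
    · refine Finset.sum_congr rfl fun k hk => ?_
      rw [← Set.ncard_coe_finset]
      congr 1
      ext x
      simp only [Finset.coe_filter, Set.Finite.mem_toFinset, stableRoots, Set.mem_ofPred_eq]
      constructor
      · rintro ⟨⟨h1, h2, h3⟩, h4⟩
        exact ⟨h1, h4, h3⟩
      · rintro ⟨h1, rfl, h3⟩
        exact ⟨⟨h1, (Finset.mem_filter.1 hk).2, h3⟩, rfl⟩
    · intro x hx
      simp only [Set.Finite.coe_toFinset, stableRoots, Set.mem_ofPred_eq] at hx
      simp only [Finset.coe_filter, Finset.mem_Icc, Set.mem_ofPred_eq]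
      refine ⟨⟨P.expPeriod_pos hx.1, Nat.le_of_dvd hNpos ?_⟩, hx.2.1⟩
      rw [P.card]
      exact (P.expPeriod_dvd_n hx.1).mul_left _
  rw [h1, Finset.mul_sum]
  refine Finset.sum_congr rfl fun k hk => ?_
  have hk1 : 0 < k := (Finset.mem_Icc.1 (Finset.mem_filter.1 hk).1).1
  rw [← P.mul_ncard_irrChars hσ hcop hk1, P.ncard_pairs hs0 hw hN hg, ← mul_assoc]
  rcases (P.stableRoots L s (· = k)).eq_empty_or_nonempty with he | ⟨x, hx, hkx, -⟩
  · rw [he]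
    simp
  · congr 1
    have hkn : k ∣ P.n := hkx ▸ P.expPeriod_dvd_n hx
    obtain ⟨q, hq⟩ := hkn
    rw [hq, Nat.mul_div_cancel_left _ hk1]
    refine gcd_mul_of_coprime hw ?_ (hN ▸ hNpos)
    rw [← hq, ← hN, P.card]
    exact dvd_mul_left _ _

end MetaPres

theorem exists_ringHom_pow_eq_of_normal {L : Type*} [Field L] [IsAlgClosed L] [CharZero L]
    [Algebra ℚ L] [Normal ℚ L] {N s : ℕ} (hN : 0 < N) (hs : s.Coprime N) :
    ∃ σ : L →+* L, ∀ z, z ^ N = 1 → σ z = z ^ s := by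
  have : NeZero N := ⟨hN.ne'⟩
  have : NeZero (N : L) := ⟨Nat.cast_ne_zero.2 hN.ne'⟩
  obtain ⟨ζ, hζ⟩ := HasEnoughRootsOfUnity.exists_primitiveRoot L N
  have hζint := hζ.isIntegral hN
  have hconj : IsConjRoot ℚ ζ (ζ ^ s) := by
    rw [IsConjRoot, minpoly.isIntegrallyClosed_eq_field_fractions' ℚ hζint,
      minpoly.isIntegrallyClosed_eq_field_fractions' ℚ (hζint.pow s),
      hζ.minpoly_eq_pow_coprime hs]
  obtain ⟨σ, hσ⟩ := (isConjRoot_iff_exists_algEquiv).1 hconj.symm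
  refine ⟨(σ : _ →+* _), fun z hz => ?_⟩
  obtain ⟨i, -, rfl⟩ := hζ.eq_pow_of_pow_eq_one hz
  simp only [RingHom.coe_coe, map_pow]
  rw [hσ, pow_right_comm]

theorem exists_ringHom_pow_eq {N s : ℕ} (hN : 0 < N) (hs : s.Coprime N) :
    ∃ σ : AlgebraicClosure ℚ →+* AlgebraicClosure ℚ, ∀ z, z ^ N = 1 → σ z = z ^ s :=
  @exists_ringHom_pow_eq_of_normal (AlgebraicClosure ℚ) _ _ _ (AlgebraicClosure.instAlgebra ℚ)
    (@IsAlgClosure.normal ℚ _ _ _ (AlgebraicClosure.instAlgebra ℚ) _) _ _ hN hs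

theorem card_eq_of_algEquiv {G H : Type*} [Group G] [Group H] [Finite G] [Finite H]
    (e : MonoidAlgebra ℚ G ≃ₐ[ℚ] MonoidAlgebra ℚ H) : Nat.card G = Nat.card H := by
  have := e.toLinearEquiv.finrank_eq
  rwa [Module.finrank_eq_nat_card_basis (MonoidAlgebra.basis G ℚ),
    Module.finrank_eq_nat_card_basis (MonoidAlgebra.basis H ℚ)] at this

theorem MetaPres.gcd_mul_ncard_congr {G H : Type*} [Group G] [Group H] [Finite G] [Finite H]
    (P : MetaPres G) (Q : MetaPres H)
    (e : MonoidAlgebra ℚ G ≃ₐ[ℚ] MonoidAlgebra ℚ H) {s w w' : ℕ} (hs0 : 0 < s)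
    (hcop : s.Coprime (Nat.card G)) (hw : w.Coprime w')
    (hN : Nat.card G = w * w') (hg : Nat.gcd (s - 1) (Nat.card G) = w) (D : ℕ → Prop) :
    Nat.gcd P.n w * (P.stableRoots (AlgebraicClosure ℚ) s D).ncard =
      Nat.gcd Q.n w * (Q.stableRoots (AlgebraicClosure ℚ) s D).ncard := by
  have hc := card_eq_of_algEquiv e
  obtain ⟨σ, hσ⟩ := exists_ringHom_pow_eq P.card_pos hcop
  rw [P.gcd_mul_ncard_stableRoots hσ hs0 hcop hw hN hg D,
    Q.gcd_mul_ncard_stableRoots (hc ▸ hσ) hs0 (hc ▸ hcop) hw (hc ▸ hN) (hc ▸ hg) D, hc]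
  refine Finset.sum_congr rfl fun k _ => ?_
  rw [ncard_irrChars_congr σ k e.toRingEquiv]

theorem ncard_pow_eq_one {L : Type*} [Field L] [IsAlgClosed L] [CharZero L] {r : ℕ} (hr : 0 < r) :
    {y : L | y ^ r = 1}.ncard = r := by
  have := ncard_pow_eq (L := L) (w := r) (w' := 1) (q := r) (z := 1) (Nat.coprime_one_right _) hr hr
    (one_pow _) (fun y hy => by rwa [mul_one])
  simpa using this

theorem modEq_of_pow_eq_pow {L : Type*} [Field L] {x : L} (hx : x ≠ 0) {i j : ℕ}
    (h : x ^ i = x ^ j) : i ≡ j [MOD orderOf x] := by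
  have h2 : Units.mk0 x hx ^ i = Units.mk0 x hx ^ j := Units.ext (by simpa using h)
  rw [pow_inj_mod] at h2
  rw [← Units.val_mk0 hx, orderOf_units]
  exact h2

theorem pow_prime_pow_modEq_one {p t : ℕ} (h : t ≡ 1 [MOD p]) (g : ℕ) :
    t ^ p ^ g ≡ 1 [MOD p ^ g] := by
  have h1 : (p : ℤ) ∣ (t : ℤ) - 1 := by
    have := (Nat.modEq_iff_dvd.1 h.symm)
    simpa using this
  have h2 := (pow_dvd_pow (p : ℤ) (Nat.le_succ g)).trans (dvd_sub_pow_of_dvd_sub h1 g)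
  refine (Nat.modEq_iff_dvd.2 ?_).symm
  simpa using h2

theorem pow_prime_pow_modEq_self {p : ℕ} (hp : p.Prime) (t e : ℕ) : t ^ p ^ e ≡ t [MOD p] := by
  have : Fact p.Prime := ⟨hp⟩
  rw [← ZMod.natCast_eq_natCast_iff]
  push_cast
  exact ZMod.pow_card_pow _

theorem pow_pow_eq_of_pow_eq {M : Type*} [Monoid M] {x : M} {s t l : ℕ} (h : x ^ s = x ^ (t ^ l))
    (j : ℕ) : x ^ (s ^ j) = x ^ (t ^ (l * j)) := by
  induction j with
  | zero => simp
  | succ j ih =>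
    rw [pow_succ, pow_mul, ih, pow_right_comm, h, ← pow_mul, ← pow_add, mul_add, mul_one, add_comm]

theorem pow_eq_one_of_neg_stable {L : Type*} [Field L] {x : L} {s w C k : ℕ} (hC : Odd C)
    (hsC : C ∣ s + 1) (hx : x ^ (w * C) = 1) (hk : Odd k) (h : x ^ (s ^ k) = x) : x ^ w = 1 := by
  have hyC : (x ^ w) ^ C = 1 := by rw [← pow_mul, hx]
  have hys : (x ^ w) ^ s * x ^ w = 1 := by
    rw [← pow_succ]
    obtain ⟨e, he⟩ := hsC
    rw [he, pow_mul, hyC, one_pow]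
  have hyk : (x ^ w) ^ s ^ k = x ^ w := by rw [pow_right_comm, h]
  have hy2 : expPeriod s (x ^ w) ∣ 2 := by
    rw [expPeriod_dvd_iff, pow_two, pow_mul]
    have h1 : ((x ^ w) ^ s) ^ s * (x ^ w) ^ s = 1 := by rw [← mul_pow, hys, one_pow]
    have h0 : (x ^ w) ^ s ≠ 0 := left_ne_zero_of_mul_eq_one hys
    exact mul_right_cancel₀ h0 (h1.trans ((mul_comm _ _).trans hys).symm)
  obtain ⟨j, rfl⟩ := hk
  have h3 : (x ^ w) ^ s = x ^ w := by
    rw [pow_succ, pow_mul, expPeriod_dvd_iff.1 (hy2.mul_right j)] at hyk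
    exact hyk
  rw [h3, ← pow_two] at hys
  have h5 := pow_gcd_eq_one.2 ⟨hys, hyC⟩
  rwa [hC.coprime_two_left, pow_one] at h5

theorem ncard_image_mul {L : Type*} [Field L] {U V : Set L} {A B : ℕ} (hAB : A.Coprime B)
    (hU : ∀ u ∈ U, u ^ A = 1) (hV : ∀ v ∈ V, v ^ B = 1) :
    ((fun p : L × L => p.1 * p.2) '' (U ×ˢ V)).ncard = U.ncard * V.ncard := by
  rw [Set.InjOn.ncard_image, Set.ncard_prod]
  have hgen : ∀ {A B : ℕ}, A.Coprime B → ∀ {u v u' v' : L}, u ^ A = 1 → u' ^ A = 1 → v ^ B = 1 →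
      v' ^ B = 1 → u * v = u' * v' → u = u' := by
    intro A B hAB u v u' v' hu hu' hv hv' h
    obtain ⟨i, hi1, hi2⟩ := Nat.chineseRemainder hAB 1 0
    have h1 : ∀ {u v : L}, u ^ A = 1 → v ^ B = 1 → (u * v) ^ i = u := by
      intro u v hu hv
      rw [mul_pow, pow_eq_pow_of_modEq_of_pow_eq_one hu hi1,
        pow_eq_pow_of_modEq_of_pow_eq_one hv hi2, pow_one, pow_zero, mul_one]
    rw [← h1 hu hv, h, h1 hu' hv']
  rintro ⟨u, v⟩ ⟨hu, hv⟩ ⟨u', v'⟩ ⟨hu', hv'⟩ h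
  simp only at hu hv hu' hv' h
  refine Prod.ext (hgen hAB (hU _ hu) (hU _ hu') (hV _ hv) (hV _ hv') h) ?_
  rw [mul_comm u, mul_comm u'] at h
  exact hgen hAB.symm (hV _ hv) (hV _ hv') (hU _ hu) (hU _ hu') h

theorem exists_mul_of_pow_eq_one {M : Type*} [Monoid M] {A B : ℕ} (hAB : A.Coprime B) :
    ∃ i j : ℕ, ∀ x : M, x ^ (A * B) = 1 →
      (x ^ i) ^ A = 1 ∧ (x ^ j) ^ B = 1 ∧ x ^ i * x ^ j = x := by
  obtain ⟨i, hi1, hi2⟩ := Nat.chineseRemainder hAB 1 0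
  obtain ⟨j, hj1, hj2⟩ := Nat.chineseRemainder hAB 0 1
  refine ⟨i, j, fun x hx => ⟨?_, ?_, ?_⟩⟩
  · obtain ⟨e, rfl⟩ := (Nat.modEq_zero_iff_dvd).1 hi2
    rw [← pow_mul, show B * e * A = A * B * e by ring, pow_mul, hx, one_pow]
  · obtain ⟨e, rfl⟩ := (Nat.modEq_zero_iff_dvd).1 hj1
    rw [← pow_mul, show A * e * B = A * B * e by ring, pow_mul, hx, one_pow]
  · rw [← pow_add]
    conv_rhs => rw [← pow_one x]
    refine pow_eq_pow_of_modEq_of_pow_eq_one hx ((Nat.modEq_and_modEq_iff_modEq_mul hAB).1 ⟨?_, ?_⟩)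
    · simpa using hi1.add hj1
    · simpa using hi2.add hj2

namespace MetaPres

variable {G : Type*} [Group G] (P : MetaPres G) {L : Type*} [Field L]

theorem t_modEq_one_of_two {g : ℕ} (h : 2 ^ g ∣ P.m) : P.t ^ 2 ^ g ≡ 1 [MOD 2 ^ g] := by
  rcases Nat.eq_zero_or_pos g with rfl | hg
  · simp [Nat.modEq_one]
  refine pow_prime_pow_modEq_one ?_ g
  have h2 : P.t.Coprime 2 := P.t_coprime.coprime_dvd_right ((dvd_pow_self 2 hg.ne').trans h)
  exact Nat.odd_iff.1 ((Nat.coprime_two_right).1 h2)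

/-- A prime `p` dividing `m` such that `b` acts nontrivially on the subgroup of order `p`. -/
def Bad (p : ℕ) : Prop := p ∣ P.m ∧ ¬ P.t ≡ 1 [MOD p]

theorem stableRoots_prime_pow_eq {p a β C s : ℕ} (hp : p.Prime) (hp2 : p ≠ 2)
    (hN : Nat.card G = 2 ^ a * p ^ β * C) (hC : Odd C) (hs : s ≡ 1 [MOD 2 ^ a * p ^ β])
    (hsC : C ∣ s + 1) :
    P.stableRoots L s (fun k => ∃ e, k = p ^ e) = (fun z : L × L => z.1 * z.2) ''
      ({u : L | u ^ Nat.gcd P.m (2 ^ a) = 1 ∧ u ^ P.t = u} ×ˢ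
        {v : L | v ^ (if P.Bad p then 1 else Nat.gcd P.m (p ^ β)) = 1}) := by
  have hcop : Nat.Coprime (2 ^ a) (p ^ β) :=
    Nat.Coprime.pow _ _ ((Nat.coprime_primes Nat.prime_two hp).2 hp2.symm)
  have hodd : Odd p := hp.odd_of_ne_two hp2
  ext x
  simp only [stableRoots, Set.mem_ofPred_eq, Set.mem_image, Set.mem_prod, Prod.exists]
  constructor
  · rintro ⟨hxm, ⟨e, he⟩, l, hl⟩
    have hfix : x ^ s ^ p ^ e = x := by
      rw [pow_pow_eq_of_pow_eq hl, ← he]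
      exact expPeriod_dvd_iff.1 (dvd_mul_left _ _)
    have hxw := pow_eq_one_of_neg_stable hC hsC (by rw [← hN]; exact P.pow_card_eq_one hxm)
      hodd.pow hfix
    obtain ⟨i, j, hij⟩ := exists_mul_of_pow_eq_one (M := L) hcop
    obtain ⟨hi, hj, hx⟩ := hij x hxw
    have hm : ∀ i, (x ^ i) ^ P.m = 1 := fun i => by rw [pow_right_comm, hxm, one_pow]
    have hu := pow_gcd_eq_one.2 ⟨hm i, hi⟩
    have hv := pow_gcd_eq_one.2 ⟨hm j, hj⟩
    refine ⟨x ^ i, x ^ j, ⟨⟨hu, ?_⟩, ?_⟩, hx⟩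
    · obtain ⟨g, -, hg⟩ := (Nat.dvd_prime_pow Nat.prime_two).1 (Nat.gcd_dvd_right P.m (2 ^ a))
      have h1 : expPeriod P.t (x ^ i) ∣ 2 ^ g := by
        rw [hg] at hu
        have := P.t_modEq_one_of_two (g := g) (hg ▸ Nat.gcd_dvd_left _ _)
        rw [expPeriod_dvd_iff, pow_eq_pow_of_modEq_of_pow_eq_one hu this, pow_one]
      have h2 : expPeriod P.t (x ^ i) ∣ p ^ e := he ▸ expPeriod_pow_dvd _ _ _
      have h3 : expPeriod P.t (x ^ i) ∣ 1 := by
        rw [← Nat.Coprime.pow g e ((Nat.coprime_primes Nat.prime_two hp).2 hp2.symm)]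
        exact Nat.dvd_gcd h1 h2
      simpa using expPeriod_dvd_iff.1 h3
    · split_ifs with hbad
      · by_contra hne
        rw [pow_one] at hne
        have hv0 : x ^ j ≠ 0 := by
          intro h0
          have := hm j
          rw [h0, zero_pow P.m_pos.ne'] at this
          exact zero_ne_one this
        obtain ⟨f, -, hf⟩ := (Nat.dvd_prime_pow hp).1 (orderOf_dvd_of_pow_eq_one hj)
        have hf0 : f ≠ 0 := by
          rintro rfl
          exact hne (orderOf_eq_one_iff.1 (by simpa using hf))
        have h1 : (x ^ j) ^ (P.t ^ p ^ e) = (x ^ j) ^ 1 := by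
          rw [pow_one, ← he]
          exact expPeriod_dvd_iff.1 (expPeriod_pow_dvd _ _ _)
        have h2 := (modEq_of_pow_eq_pow hv0 h1).of_dvd (hf ▸ dvd_pow_self p hf0)
        exact hbad.2 ((pow_prime_pow_modEq_self hp _ _).symm.trans h2)
      · exact hv
  · rintro ⟨u, v, ⟨⟨hu, hut⟩, hv⟩, rfl⟩
    have hv' : v ^ Nat.gcd P.m (p ^ β) = 1 := by
      split_ifs at hv
      · rw [pow_one] at hv
        rw [hv, one_pow]
      · exact hv
    have hu1 := pow_gcd_eq_one.1 hu
    have hv1 := pow_gcd_eq_one.1 hv'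
    have hvt : v ^ P.t ^ p ^ β = v := by
      by_cases ht : P.t ≡ 1 [MOD p]
      · rw [pow_eq_pow_of_modEq_of_pow_eq_one hv1.2 (pow_prime_pow_modEq_one ht β), pow_one]
      · have : v = 1 := by
          by_cases hpm : p ∣ P.m
          · rwa [if_pos (show P.Bad p from ⟨hpm, ht⟩), pow_one] at hv
          · rwa [(((Nat.Prime.coprime_iff_not_dvd hp).2 hpm).symm.pow_right β), pow_one] at hv'
        simp [this]
    have hut' : u ^ P.t ^ p ^ β = u := by
      refine expPeriod_dvd_iff.1 (dvd_trans ?_ (one_dvd _))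
      rw [expPeriod_dvd_iff, pow_one, hut]
    refine ⟨by rw [mul_pow, hu1.1, hv1.1, one_mul], ?_, 0, ?_⟩
    · obtain ⟨e, -, he⟩ := (Nat.dvd_prime_pow hp).1
        (expPeriod_dvd_iff.2 (show (u * v) ^ P.t ^ p ^ β = u * v by rw [mul_pow, hut', hvt]))
      exact ⟨e, he⟩
    · rw [pow_zero]
      refine pow_eq_pow_of_modEq_of_pow_eq_one (m := 2 ^ a * p ^ β) ?_ hs
      rw [mul_pow, pow_mul, hu1.2, pow_mul v, pow_right_comm, hv1.2, one_pow, one_pow, one_mul]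

theorem ncard_stableRoots_prime_pow [IsAlgClosed L] [CharZero L] {p a β C s : ℕ} (hp : p.Prime)
    (hp2 : p ≠ 2) (hN : Nat.card G = 2 ^ a * p ^ β * C) (hC : Odd C)
    (hs : s ≡ 1 [MOD 2 ^ a * p ^ β]) (hsC : C ∣ s + 1) :
    (P.stableRoots L s (fun k => ∃ e, k = p ^ e)).ncard =
      {u : L | u ^ Nat.gcd P.m (2 ^ a) = 1 ∧ u ^ P.t = u}.ncard *
        (if P.Bad p then 1 else Nat.gcd P.m (p ^ β)) := by
  have hcop : Nat.Coprime (2 ^ a) (p ^ β) :=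
    Nat.Coprime.pow _ _ ((Nat.coprime_primes Nat.prime_two hp).2 hp2.symm)
  rw [P.stableRoots_prime_pow_eq hp hp2 hN hC hs hsC, ncard_image_mul hcop, ncard_pow_eq_one]
  · split_ifs
    · exact one_pos
    · exact Nat.gcd_pos_of_pos_left _ P.m_pos
  · exact fun u hu => (pow_gcd_eq_one.1 hu.1).2
  · intro v hv
    rw [Set.mem_ofPred_eq] at hv
    split_ifs at hv
    · rw [pow_one] at hv
      rw [hv, one_pow]
    · exact (pow_gcd_eq_one.1 hv).2

end MetaPres

theorem gcd_ordProj {p m N : ℕ} (hp : p.Prime) (hN : N ≠ 0) (h : m ∣ N) :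
    Nat.gcd m (ordProj[p] N) = ordProj[p] m := by
  have hm : m ≠ 0 := ne_zero_of_dvd_ne_zero hN h
  refine Nat.dvd_antisymm ?_ (Nat.dvd_gcd (Nat.ordProj_dvd _ _)
    (Nat.ordProj_dvd_ordProj_of_dvd hN h p))
  obtain ⟨e, -, he⟩ := (Nat.dvd_prime_pow hp).1 (Nat.gcd_dvd_right m (ordProj[p] N))
  rw [he]
  refine pow_dvd_pow p ((hp.pow_dvd_iff_le_factorization hm).1 ?_)
  rw [← he]
  exact Nat.gcd_dvd_left _ _

theorem gcd_pred_eq {s w C : ℕ} (hs0 : 0 < s) (hC : Odd C) (hs : s ≡ 1 [MOD w]) (hsC : C ∣ s + 1)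
    (hw : w.Coprime C) : Nat.gcd (s - 1) (w * C) = w := by
  rw [hw.gcd_mul]
  have h1 : w ∣ s - 1 := (Nat.modEq_iff_dvd' hs0).1 hs.symm
  have h2 : Nat.gcd (s - 1) C = 1 := by
    have h3 : Nat.gcd (s - 1) C ∣ 2 := by
      have := Nat.dvd_sub ((Nat.gcd_dvd_right (s - 1) C).trans hsC) (Nat.gcd_dvd_left (s - 1) C)
      rwa [show s + 1 - (s - 1) = 2 by omega] at this
    exact Nat.eq_one_of_dvd_coprimes hC.coprime_two_left h3 (Nat.gcd_dvd_right _ _)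
  rw [h2, mul_one, Nat.gcd_eq_right h1]

theorem coprime_of_dvd_add_one {s C : ℕ} (h : C ∣ s + 1) : s.Coprime C :=
  Nat.Coprime.coprime_dvd_right h (by simp)

theorem exists_one_neg_one {w C : ℕ} (hC : Odd C) (hw : w.Coprime C) (hw0 : 0 < w) :
    ∃ s, 0 < s ∧ s ≡ 1 [MOD w] ∧ C ∣ s + 1 ∧ s.Coprime (w * C) ∧ Nat.gcd (s - 1) (w * C) = w := by
  obtain ⟨s, hs1, hs2⟩ := Nat.chineseRemainder hw 1 (C - 1)
  have hCpos := hC.pos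
  have h1 : s + w * C ≡ 1 [MOD w] := by
    simpa using hs1.add ((Nat.modEq_zero_iff_dvd).2 (dvd_mul_right w C))
  have h2 : C ∣ s + w * C + 1 := by
    have h3 := hs2.add_right 1
    rw [Nat.sub_add_cancel hCpos] at h3
    have h4 := (Nat.modEq_zero_iff_dvd).1 (h3.trans (Nat.modEq_zero_iff_dvd.2 dvd_rfl))
    rw [add_right_comm]
    exact dvd_add h4 (dvd_mul_left _ _)
  have h0 : 0 < s + w * C := Nat.add_pos_right _ (Nat.mul_pos hw0 hCpos)
  refine ⟨s + w * C, h0, h1, h2, Nat.Coprime.mul_right ?_ (coprime_of_dvd_add_one h2),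
    gcd_pred_eq h0 hC h1 h2 hw⟩
  rw [Nat.Coprime, h1.gcd_eq]
  simp

namespace MetaPres

variable {G H : Type*} [Group G] [Group H] [Finite G] [Finite H] (P : MetaPres G) (Q : MetaPres H)
  (e : MonoidAlgebra ℚ G ≃ₐ[ℚ] MonoidAlgebra ℚ H)

/-- The number of `m`-th roots of unity of order a divisor of `2 ^ a` fixed by `x ↦ x ^ t`. -/
def twoFixed {G : Type*} [Group G] (P : MetaPres G) (a : ℕ) : ℕ :=
  {u : AlgebraicClosure ℚ | u ^ Nat.gcd P.m (2 ^ a) = 1 ∧ u ^ P.t = u}.ncard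

omit [Finite G] in
theorem twoFixed_pos (a : ℕ) : 0 < P.twoFixed a := by
  exact (Set.ncard_pos ((finite_setOf_pow_eq_one (Nat.gcd_pos_of_pos_left _ P.m_pos)).subset
    fun _ h => h.1)).2 ⟨1, by simp⟩

include e in
theorem gcd_mul_twoFixed_congr {p a β C : ℕ} (hp : p.Prime) (hp2 : p ≠ 2)
    (hN : Nat.card G = 2 ^ a * p ^ β * C) (hC : Odd C) (hw : (2 ^ a * p ^ β).Coprime C) :
    Nat.gcd P.n (2 ^ a * p ^ β) *
      (P.twoFixed a * if P.Bad p then 1 else Nat.gcd P.m (p ^ β)) =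
    Nat.gcd Q.n (2 ^ a * p ^ β) *
      (Q.twoFixed a * if Q.Bad p then 1 else Nat.gcd Q.m (p ^ β)) := by
  have hw0 : 0 < 2 ^ a * p ^ β := Nat.mul_pos (by positivity) (Nat.pow_pos hp.pos)
  obtain ⟨s, hs0, hs1, hsC, hcop, hg⟩ := exists_one_neg_one hC hw hw0
  have := P.gcd_mul_ncard_congr Q e hs0 (hN ▸ hcop) hw hN (hN ▸ hg) (fun k => ∃ e, k = p ^ e)
  rwa [P.ncard_stableRoots_prime_pow hp hp2 hN hC hs1 hsC,
    Q.ncard_stableRoots_prime_pow hp hp2 (card_eq_of_algEquiv e ▸ hN) hC hs1 hsC] at this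

include e in
theorem gcd_mul_twoFixed_congr_two {a C : ℕ} (hN : Nat.card G = 2 ^ a * C) (hC : Odd C) :
    Nat.gcd P.n (2 ^ a) * P.twoFixed a = Nat.gcd Q.n (2 ^ a) * Q.twoFixed a := by
  have := P.gcd_mul_twoFixed_congr Q e (p := 3) (a := a) (β := 0) (C := C)
    Nat.prime_three (by norm_num)
    (by rw [pow_zero, mul_one, hN]) hC
    (by rw [pow_zero, mul_one]; exact Nat.Coprime.pow_left _ hC.coprime_two_left)
  simpa using this

omit [Finite G] in
theorem gcd_m_mul_gcd_n {p : ℕ} (hp : p.Prime) :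
    Nat.gcd P.m (ordProj[p] (Nat.card G)) * Nat.gcd P.n (ordProj[p] (Nat.card G)) =
      ordProj[p] (Nat.card G) := by
  have h0 := P.card_pos
  rw [← gcd_mul_of_coprime (w' := ordCompl[p] (Nat.card G)), ← P.card,
    Nat.gcd_eq_right (Nat.ordProj_dvd _ _)]
  · exact Nat.Coprime.pow_left _ (Nat.coprime_ordCompl hp h0.ne')
  · rw [Nat.ordProj_mul_ordCompl_eq_self, P.card]
  · rw [Nat.ordProj_mul_ordCompl_eq_self]
    exact h0

include e in
theorem gcd_n_mul_congr {p : ℕ} (hp : p.Prime) (hp2 : p ≠ 2) :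
    Nat.gcd P.n (ordProj[p] (Nat.card G)) *
      (if P.Bad p then 1 else Nat.gcd P.m (ordProj[p] (Nat.card G))) =
    Nat.gcd Q.n (ordProj[p] (Nat.card G)) *
      (if Q.Bad p then 1 else Nat.gcd Q.m (ordProj[p] (Nat.card G))) := by
  have h0 := P.card_pos.ne'
  set N := Nat.card G with hN
  have hC : Odd (ordCompl[2] N) :=
    Nat.Coprime.odd_of_left (Nat.coprime_ordCompl Nat.prime_two h0)
  have hc0 : ordCompl[2] N ≠ 0 := (Nat.ordCompl_pos 2 h0).ne'
  have hfac : (ordCompl[2] N).factorization p = N.factorization p := by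
    rw [Nat.factorization_ordCompl]
    simp [hp2]
  have h3 : p ^ N.factorization p * ordCompl[p] (ordCompl[2] N) = ordCompl[2] N := by
    rw [← hfac]
    exact Nat.ordProj_mul_ordCompl_eq_self _ _
  have hC2 : Odd (ordCompl[p] (ordCompl[2] N)) := by
    rw [← h3] at hC
    exact (Nat.odd_mul.1 hC).2
  have key := P.gcd_mul_twoFixed_congr Q e (a := N.factorization 2) (β := N.factorization p)
    (C := ordCompl[p] (ordCompl[2] N)) hp hp2
    (by rw [mul_assoc, h3, Nat.ordProj_mul_ordCompl_eq_self])
    hC2 (Nat.Coprime.mul_left (Nat.Coprime.pow_left _ hC2.coprime_two_left)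
      (Nat.Coprime.pow_left _ (Nat.coprime_ordCompl hp hc0)))
  have key2 := P.gcd_mul_twoFixed_congr_two Q e (a := N.factorization 2) (C := ordCompl[2] N)
    (by rw [Nat.ordProj_mul_ordCompl_eq_self]) hC
  have hcop : Nat.Coprime (2 ^ N.factorization 2) (p ^ N.factorization p) :=
    Nat.Coprime.pow _ _ ((Nat.coprime_primes Nat.prime_two hp).2 hp2.symm)
  rw [hcop.gcd_mul, hcop.gcd_mul] at key
  have hpos : 0 < Nat.gcd P.n (2 ^ N.factorization 2) * P.twoFixed (N.factorization 2) :=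
    Nat.mul_pos (Nat.gcd_pos_of_pos_left _ P.n_pos) (P.twoFixed_pos _)
  refine Nat.eq_of_mul_eq_mul_left hpos ?_
  calc _ = _ := by ring
    _ = _ := key
    _ = _ := by rw [key2]; ring

include e in
theorem bad_of_algEquiv {p : ℕ} (hp : p.Prime) (hp2 : p ≠ 2) (hP : P.Bad p) : Q.Bad p := by
  by_contra hQ
  have h := P.gcd_n_mul_congr Q e hp hp2
  have hc := card_eq_of_algEquiv e
  rw [if_pos hP, if_neg hQ, mul_one] at h
  have h2 := Q.gcd_m_mul_gcd_n hp
  rw [← hc, mul_comm, ← h] at h2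
  have h3 := P.gcd_m_mul_gcd_n hp
  have hpos : 0 < Nat.gcd P.n (ordProj[p] (Nat.card G)) := Nat.gcd_pos_of_pos_left _ P.n_pos
  have h4 : Nat.gcd P.m (ordProj[p] (Nat.card G)) = 1 :=
    Nat.eq_of_mul_eq_mul_right hpos (by rw [h3, one_mul, h2])
  have hmN : P.m ∣ Nat.card G := P.card ▸ dvd_mul_right _ _
  have h5 : p ∣ Nat.gcd P.m (ordProj[p] (Nat.card G)) := by
    refine Nat.dvd_gcd hP.1 (dvd_pow_self _ ?_)
    exact (hp.factorization_pos_of_dvd P.card_pos.ne' (hP.1.trans hmN)).ne'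
  rw [h4] at h5
  exact hp.one_lt.ne' (Nat.dvd_one.1 h5)

omit [Finite G] in
theorem not_bad_two : ¬ P.Bad 2 := by
  rintro ⟨h1, h2⟩
  have h3 : P.t.Coprime 2 := P.t_coprime.coprime_dvd_right h1
  exact h2 (Nat.odd_iff.1 ((Nat.coprime_two_right).1 h3))

include e in
theorem bad_iff {p : ℕ} (hp : p.Prime) : P.Bad p ↔ Q.Bad p := by
  rcases eq_or_ne p 2 with rfl | hp2
  · exact iff_of_false P.not_bad_two Q.not_bad_two
  · exact ⟨P.bad_of_algEquiv Q e hp hp2, Q.bad_of_algEquiv P e.symm hp hp2⟩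

include e in
theorem ordProj_eq_of_bad {p : ℕ} (hp : p.Prime) (hP : P.Bad p) :
    ordProj[p] P.m = ordProj[p] Q.m := by
  have hp2 : p ≠ 2 := by
    rintro rfl
    exact P.not_bad_two hP
  have hQ := (P.bad_iff Q e hp).1 hP
  have h := P.gcd_n_mul_congr Q e hp hp2
  have hc := card_eq_of_algEquiv e
  rw [if_pos hP, if_pos hQ, mul_one, mul_one] at h
  have h2 := Q.gcd_m_mul_gcd_n hp
  rw [← hc, ← h] at h2
  have h3 := P.gcd_m_mul_gcd_n hp
  have hpos : 0 < Nat.gcd P.n (ordProj[p] (Nat.card G)) := Nat.gcd_pos_of_pos_left _ P.n_pos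
  have h4 := Nat.eq_of_mul_eq_mul_right hpos (h3.trans h2.symm)
  rwa [gcd_ordProj hp P.card_pos.ne' (P.card ▸ dvd_mul_right _ _),
    gcd_ordProj hp P.card_pos.ne' (hc ▸ Q.card ▸ dvd_mul_right _ _)] at h4

/-- The part of `m` at the primes `p` such that `b` acts nontrivially on the subgroup of
order `p`. -/
def badPart {G : Type*} [Group G] (P : MetaPres G) : ℕ := natPart P.m {p | P.Bad p}

omit [Finite G] in
theorem badPart_eq : P.badPart =
    ∏ p ∈ P.m.primeFactors.filter (fun p => P.Bad p), ordProj[p] P.m := by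
  rw [badPart, natPart, Finset.prod_filter]
  rfl

include e in
theorem badPart_congr : P.badPart = Q.badPart := by
  rw [badPart_eq, badPart_eq]
  refine Finset.prod_congr ?_ ?_
  · ext p
    simp only [Finset.mem_filter, Nat.mem_primeFactors]
    constructor
    · rintro ⟨⟨hp, -, -⟩, hb⟩
      have hb' := (P.bad_iff Q e hp).1 hb
      exact ⟨⟨hp, hb'.1, Q.m_pos.ne'⟩, hb'⟩
    · rintro ⟨⟨hp, -, -⟩, hb⟩
      have hb' := (P.bad_iff Q e hp).2 hb
      exact ⟨⟨hp, hb'.1, P.m_pos.ne'⟩, hb'⟩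
  · intro p hp
    simp only [Finset.mem_filter, Nat.mem_primeFactors] at hp
    have hp' := hp.1.1
    exact P.ordProj_eq_of_bad Q e hp' ((P.bad_iff Q e hp').2 hp.2)

end MetaPres

theorem natPart_mul_natPart_compl {m : ℕ} (hm : m ≠ 0) (σ : Set ℕ) :
    natPart m σ * natPart m σᶜ = m := by
  rw [natPart, natPart, ← Finset.prod_mul_distrib]
  conv_rhs => rw [← Nat.prod_factorization_pow_eq_self hm]
  refine Finset.prod_congr rfl fun p _ => ?_
  by_cases h : p ∈ σ <;> simp [h]

theorem mem_of_dvd_natPart {m p : ℕ} {σ : Set ℕ} (hp : p.Prime) (h : p ∣ natPart m σ) :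
    p ∣ m ∧ p ∈ σ := by
  obtain ⟨q, hq, hpq⟩ := (hp.prime.dvd_finsetProd_iff _).1 h
  split_ifs at hpq with hqσ
  · have hq' := Nat.prime_of_mem_primeFactors hq
    rw [(Nat.prime_dvd_prime_iff_eq hp hq').1 (hp.dvd_of_dvd_pow hpq)]
    exact ⟨Nat.dvd_of_mem_primeFactors hq, hqσ⟩
  · exact absurd (Nat.dvd_one.1 hpq) hp.ne_one

theorem natPart_dvd {m : ℕ} (hm : m ≠ 0) (σ : Set ℕ) : natPart m σ ∣ m :=
  Dvd.intro _ (natPart_mul_natPart_compl hm σ)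

theorem coprime_of_forall_prime {A B : ℕ} {σ : ℕ → Prop} (hA : ∀ p, p.Prime → p ∣ A → σ p)
    (hB : ∀ p, p.Prime → p ∣ B → ¬ σ p) : A.Coprime B :=
  Nat.coprime_of_dvd fun p hp h1 h2 => hB p hp h2 (hA p hp h1)

theorem exists_mul_mul_eq {N : ℕ} (hN : N ≠ 0) (σ : ℕ → Prop) :
    ∃ A E C, N = 2 ^ A * (E * C) ∧ Odd (E * C) ∧ (∀ p, p.Prime → p ∣ E → σ p) ∧
      ∀ p, p.Prime → p ∣ C → ¬ σ p := by
  have hc0 : ordCompl[2] N ≠ 0 := (Nat.ordCompl_pos 2 hN).ne'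
  refine ⟨N.factorization 2, natPart (ordCompl[2] N) {p | σ p}, natPart (ordCompl[2] N) {p | σ p}ᶜ,
    ?_, ?_, fun p hp h => (mem_of_dvd_natPart hp h).2, fun p hp h => (mem_of_dvd_natPart hp h).2⟩
  · rw [natPart_mul_natPart_compl hc0, Nat.ordProj_mul_ordCompl_eq_self]
  · rw [natPart_mul_natPart_compl hc0]
    exact Nat.Coprime.odd_of_left (Nat.coprime_ordCompl Nat.prime_two hN)

/-- An exponent congruent to `1`, `t` and `-1` modulo the three factors of `w * (E * C)`. -/
structure IsTwist (t w E C s : ℕ) : Prop where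
  pos : 0 < s
  modEq_one : s ≡ 1 [MOD w]
  modEq : s ≡ t [MOD E]
  dvd_add_one : C ∣ s + 1

theorem exists_isTwist {t w E C : ℕ} (hw0 : 0 < w) (hodd : Odd (E * C)) (hw : w.Coprime (E * C))
    (hEC : E.Coprime C) : ∃ s, IsTwist t w E C s := by
  have hE0 := Nat.pos_of_mul_pos_right hodd.pos
  have hC0 := Nat.pos_of_mul_pos_left hodd.pos
  obtain ⟨r, hr1, hr2⟩ := Nat.chineseRemainder hEC t (C - 1)
  obtain ⟨s, hs1, hs2⟩ := Nat.chineseRemainder hw 1 r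
  refine ⟨s + w * (E * C), by positivity, ?_, ?_, ?_⟩
  · simpa using hs1.add ((Nat.modEq_zero_iff_dvd).2 (dvd_mul_right w (E * C)))
  · have := (hs2.of_mul_right C).trans hr1
    simpa using this.add ((Nat.modEq_zero_iff_dvd).2
      ((dvd_mul_right E C).trans (dvd_mul_left _ w)))
  · have h3 := ((hs2.of_mul_left E).trans hr2).add_right 1
    rw [Nat.sub_add_cancel hC0] at h3
    have h4 := (Nat.modEq_zero_iff_dvd).1 (h3.trans (Nat.modEq_zero_iff_dvd.2 dvd_rfl))
    rw [add_right_comm]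
    exact dvd_add h4 ((dvd_mul_left C E).trans (dvd_mul_left _ _))

namespace IsTwist

variable {t w E C s : ℕ} (h : IsTwist t w E C s)
include h

theorem coprime (ht : t.Coprime E) : s.Coprime (w * (E * C)) := by
  refine Nat.Coprime.mul_right ?_ (Nat.Coprime.mul_right ?_ (coprime_of_dvd_add_one h.dvd_add_one))
  · rw [Nat.Coprime, h.modEq_one.gcd_eq]
    simp
  · rw [Nat.Coprime, h.modEq.gcd_eq]
    exact ht

theorem gcd_pred (hodd : Odd (E * C)) (hw : w.Coprime (E * C))
    (ht : ∀ p, p.Prime → p ∣ E → ¬ t ≡ 1 [MOD p]) : Nat.gcd (s - 1) (w * (E * C)) = w := by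
  rw [hw.gcd_mul, Nat.gcd_eq_right ((Nat.modEq_iff_dvd' h.pos).1 h.modEq_one.symm)]
  suffices h1 : (s - 1).Coprime (E * C) by rw [h1, mul_one]
  refine Nat.Coprime.mul_right (Nat.coprime_of_dvd fun p hp h1 h2 => ?_)
    (Nat.coprime_of_dvd fun p hp h1 h2 => ?_)
  · exact ht p hp h2 (((h.modEq.of_dvd h2).symm).trans ((Nat.modEq_iff_dvd' h.pos).2 h1).symm)
  · have h3 := Nat.dvd_sub (h2.trans h.dvd_add_one) h1
    have hs := h.pos
    rw [show s + 1 - (s - 1) = 2 by omega, Nat.prime_dvd_prime_iff_eq hp Nat.prime_two] at h3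
    subst h3
    exact (Nat.not_even_iff_odd.2 hodd) ((even_iff_two_dvd).2 (h2.trans (dvd_mul_left _ _)))

end IsTwist

theorem ordProj_dvd_ordProj_two_half {j k : ℕ} (hk : 0 < k) (h2 : 2 ∣ k) (h : j ∣ k / 2) :
    ordProj[2] j < ordProj[2] k := by
  obtain ⟨q, rfl⟩ := h2
  rw [Nat.mul_div_cancel_left _ two_pos] at h
  have hq : q ≠ 0 := by rintro rfl; simp at hk
  refine lt_of_le_of_lt (Nat.le_of_dvd (by positivity)
    (Nat.ordProj_dvd_ordProj_of_dvd hq h 2)) ?_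
  rw [Nat.factorization_mul two_ne_zero hq]
  refine Nat.pow_lt_pow_right one_lt_two ?_
  simp [Nat.prime_two.factorization_self]

theorem expPeriod_dvd_of_pow_eq {M : Type*} [Monoid M] {x : M} {s t l : ℕ}
    (h : x ^ s = x ^ (t ^ l)) : expPeriod s x ∣ expPeriod t x := by
  rw [expPeriod_dvd_iff, pow_pow_eq_of_pow_eq h]
  exact expPeriod_dvd_iff.1 (dvd_mul_left _ _)

namespace MetaPres

section

variable {G : Type*} [Group G] (P : MetaPres G) {L : Type*} [Field L]

theorem badPart_dvd : P.badPart ∣ P.m := natPart_dvd P.m_pos.ne' _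

theorem gcd_dvd_badPart {E : ℕ} (hE : ∀ p, p.Prime → p ∣ E → P.Bad p) :
    Nat.gcd P.m E ∣ P.badPart := by
  have h := natPart_mul_natPart_compl P.m_pos.ne' {p | P.Bad p}
  have hc : (natPart P.m {p | P.Bad p}ᶜ).Coprime E :=
    (coprime_of_forall_prime hE fun p hp h => (mem_of_dvd_natPart hp h).2).symm
  conv_lhs => rw [← h]
  rw [Nat.Coprime.gcd_mul_right_cancel _ hc]
  exact Nat.gcd_dvd_left _ _

theorem t_coprime_of_bad {E : ℕ} (hE : ∀ p, p.Prime → p ∣ E → P.Bad p) : P.t.Coprime E :=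
  Nat.coprime_of_dvd fun p hp h1 h2 =>
    hp.one_lt.ne' (Nat.eq_one_of_dvd_coprimes P.t_coprime h1 (hE p hp h2).1)

theorem badPart_dvd_of_card {w E C : ℕ} (hN : Nat.card G = 2 ^ w * (E * C))
    (hC : ∀ p, p.Prime → p ∣ C → ¬ P.Bad p) : P.badPart ∣ E := by
  have h1 : P.badPart ∣ 2 ^ w * (E * C) :=
    hN ▸ P.card ▸ P.badPart_dvd.trans (dvd_mul_right _ _)
  have hb : ∀ p, p.Prime → p ∣ P.badPart → P.Bad p := fun p hp h => (mem_of_dvd_natPart hp h).2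
  have h2 : P.badPart.Coprime (2 ^ w) := coprime_of_forall_prime hb fun p hp h => by
    rw [(Nat.prime_dvd_prime_iff_eq hp Nat.prime_two).1 (hp.dvd_of_dvd_pow h)]
    exact P.not_bad_two
  exact (coprime_of_forall_prime hb hC).dvd_of_dvd_mul_right (h2.dvd_of_dvd_mul_left h1)

theorem pow_eq_one_of_mem_stableRoots {w E C s : ℕ} {D : ℕ → Prop}
    (hN : Nat.card G = w * (E * C)) (hodd : Odd C) (hC : ∀ p, p.Prime → p ∣ C → ¬ P.Bad p)
    (hs : C ∣ s + 1) {x : L} (hx : x ∈ P.stableRoots L s D) : x ^ (w * E) = 1 := by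
  obtain ⟨hm, -, l, hl⟩ := hx
  have hyC : (x ^ (w * E)) ^ C = 1 := by rw [← pow_mul, mul_assoc, ← hN, P.pow_card_eq_one hm]
  have hym : (x ^ (w * E)) ^ P.m = 1 := by rw [pow_right_comm, hm, one_pow]
  by_contra hne
  obtain ⟨p, hp, hpo⟩ := Nat.exists_prime_and_dvd (mt orderOf_eq_one_iff.1 hne)
  have hpC := hpo.trans (orderOf_dvd_of_pow_eq_one hyC)
  have hpm := hpo.trans (orderOf_dvd_of_pow_eq_one hym)
  have hy0 : x ^ (w * E) ≠ 0 := by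
    intro h0
    rw [h0, zero_pow P.m_pos.ne'] at hym
    exact zero_ne_one hym
  have ht : P.t ≡ 1 [MOD p] := by
    by_contra ht
    exact hC p hp hpC ⟨hpm, ht⟩
  have h1 : s ≡ P.t ^ l [MOD p] := by
    refine (modEq_of_pow_eq_pow hy0 ?_).of_dvd hpo
    rw [pow_right_comm, hl, pow_right_comm]
  have h2 := (h1.trans (ht.pow l)).add_right 1
  rw [one_pow] at h2
  have h3 : p ∣ 2 := (h2.symm.dvd_iff dvd_rfl).2 (hpC.trans hs)
  rw [(Nat.prime_dvd_prime_iff_eq hp Nat.prime_two)] at h3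
  subst h3
  exact (Nat.not_even_iff_odd.2 hodd) (even_iff_two_dvd.2 hpC)

theorem exists_expPeriod_eq_two_pow {A : ℕ} {u : L} (hu : u ^ 2 ^ A = 1) (hum : u ^ P.m = 1) :
    ∃ g, expPeriod P.t u = 2 ^ g := by
  have hu' := pow_gcd_eq_one.2 ⟨hum, hu⟩
  obtain ⟨g, -, hg⟩ := (Nat.dvd_prime_pow Nat.prime_two).1 (Nat.gcd_dvd_right P.m (2 ^ A))
  rw [hg] at hu'
  have := P.t_modEq_one_of_two (g := g) (hg ▸ Nat.gcd_dvd_left _ _)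
  obtain ⟨i, -, hi⟩ := (Nat.dvd_prime_pow Nat.prime_two (i := expPeriod P.t u) (m := g)).1 (by
    rw [expPeriod_dvd_iff, pow_eq_pow_of_modEq_of_pow_eq_one hu' this, pow_one])
  exact ⟨i, hi⟩

theorem stableRoots_subset {A E C s s' t₀ κ : ℕ} (hN : Nat.card G = 2 ^ A * (E * C))
    (hodd : Odd (E * C)) (hE : ∀ p, p.Prime → p ∣ E → P.Bad p)
    (hC : ∀ p, p.Prime → p ∣ C → ¬ P.Bad p) (hs : IsTwist t₀ (2 ^ A) E C s)
    (hs' : IsTwist P.t (2 ^ A) E C s')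
    (ih : ∀ κ' < κ, ∀ v : L, v ^ P.badPart = 1 → ordProj[2] (expPeriod t₀ v) = κ' →
      ordProj[2] (expPeriod P.t v) = κ') :
    P.stableRoots L s (fun k => ordProj[2] k = κ) ⊆
      P.stableRoots L s' (fun k => ordProj[2] k = κ) := by
  intro x hx
  have hwE := P.pow_eq_one_of_mem_stableRoots hN (Nat.odd_mul.1 hodd).2 hC hs.dvd_add_one hx
  obtain ⟨hm, hκ, l, hl⟩ := hx
  have hcop : (2 ^ A).Coprime E := Nat.Coprime.pow_left _ (Nat.odd_mul.1 hodd).1.coprime_two_left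
  obtain ⟨i, j, hij⟩ := exists_mul_of_pow_eq_one (M := L) hcop
  obtain ⟨hu, hv, huv⟩ := hij x hwE
  have hpm : ∀ i, (x ^ i) ^ P.m = 1 := fun i => by rw [pow_right_comm, hm, one_pow]
  have hpl : ∀ i, (x ^ i) ^ s = (x ^ i) ^ P.t ^ l := fun i => by
    rw [pow_right_comm, hl, pow_right_comm]
  have hvd : ∀ i, expPeriod P.t (x ^ i) ∣ expPeriod P.t x := fun i => expPeriod_pow_dvd _ _ _
  have hpu := hpm i
  have hpv := hpm j
  have hlu := hpl i
  have hlv := hpl j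
  have hvκ : ordProj[2] (expPeriod P.t (x ^ j)) ≤ κ := by
    rw [← hκ]
    exact Nat.le_of_dvd (by positivity)
      (Nat.ordProj_dvd_ordProj_of_dvd (P.expPeriod_pos hm).ne' (hvd j) 2)
  generalize x ^ i = u at *
  generalize x ^ j = v at *
  rw [pow_eq_pow_of_modEq_of_pow_eq_one hu hs.modEq_one, pow_one] at hlu
  rw [pow_eq_pow_of_modEq_of_pow_eq_one hv hs.modEq] at hlv
  have hkv := P.expPeriod_pos hpv
  have hcopr : (expPeriod P.t u).Coprime (expPeriod P.t v) := by
    obtain ⟨g, hg⟩ := P.exists_expPeriod_eq_two_pow hu hpu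
    rw [hg]
    by_contra hnc
    have hg0 : g ≠ 0 := by
      rintro rfl
      simp at hnc
    have h2v : 2 ∣ expPeriod P.t v := by
      by_contra h2
      exact hnc (Nat.Coprime.pow_left _ ((Nat.Prime.coprime_iff_not_dvd Nat.prime_two).2 h2))
    have h2l : 2 ∣ l := (dvd_pow_self 2 hg0).trans (hg ▸ expPeriod_dvd_iff.2 hlu.symm)
    have h3 : expPeriod t₀ v ∣ expPeriod P.t v / 2 := by
      rw [expPeriod_dvd_iff, pow_pow_eq_of_pow_eq hlv]
      refine expPeriod_dvd_iff.1 ?_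
      obtain ⟨q, hq⟩ := h2v
      obtain ⟨l', rfl⟩ := h2l
      rw [hq, Nat.mul_div_cancel_left _ two_pos]
      exact ⟨l', by ring⟩
    have h4 := ordProj_dvd_ordProj_two_half hkv h2v h3
    have hvb : v ^ P.badPart = 1 :=
      orderOf_dvd_iff_pow_eq_one.1 ((orderOf_dvd_of_pow_eq_one
        (pow_gcd_eq_one.2 ⟨hpv, hv⟩)).trans (P.gcd_dvd_badPart hE))
    exact h4.ne (ih _ (h4.trans_le hvκ) v hvb rfl).symm
  obtain ⟨l', hl1, hl2⟩ := Nat.chineseRemainder hcopr 0 1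
  refine ⟨hm, hκ, l', ?_⟩
  rw [← huv, mul_pow, mul_pow, pow_eq_pow_of_modEq_of_pow_eq_one hu hs'.modEq_one, pow_one,
    pow_eq_pow_of_modEq_of_pow_eq_one hv hs'.modEq,
    expPeriod_dvd_iff.1 ((Nat.modEq_zero_iff_dvd).1 hl1), ← pow_pow_mod_expPeriod P.t l' v, hl2,
    pow_pow_mod_expPeriod, pow_one]

theorem mem_stableRoots_of_isTwist {w E C s : ℕ} (hs : IsTwist P.t w E C s) (hE : P.badPart ∣ E)
    {D : ℕ → Prop} {v : L} (hv : v ^ P.badPart = 1) (hD : D (expPeriod P.t v)) :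
    v ∈ P.stableRoots L s D := by
  have h : ∀ {k}, P.badPart ∣ k → v ^ k = 1 := by
    rintro _ ⟨q, rfl⟩
    rw [pow_mul, hv, one_pow]
  exact ⟨h P.badPart_dvd, hD, 1, by
    rw [pow_one, pow_eq_pow_of_modEq_of_pow_eq_one (h hE) hs.modEq]⟩

end

variable {G H : Type*} [Group G] [Group H] [Finite G] [Finite H] (P : MetaPres G) (Q : MetaPres H)
  (e : MonoidAlgebra ℚ G ≃ₐ[ℚ] MonoidAlgebra ℚ H)

omit [Finite G] [Finite H] in
theorem exists_pow_eq_of_forall {L : Type*} [Field L] {κ : ℕ} {s s' w E C : ℕ}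
    (hb : P.badPart = Q.badPart) (hE : Q.badPart ∣ E)
    (hs : IsTwist P.t w E C s) (hs' : IsTwist Q.t w E C s')
    (heq : Q.stableRoots L s (fun k => ordProj[2] k = κ) =
      Q.stableRoots L s' (fun k => ordProj[2] k = κ))
    (ih : ∀ κ' < κ, ∀ v : L, v ^ P.badPart = 1 → ordProj[2] (expPeriod P.t v) = κ' →
      ordProj[2] (expPeriod Q.t v) = κ')
    {v : L} (hv : v ^ P.badPart = 1) (hκ : ordProj[2] (expPeriod Q.t v) = κ) :
    ordProj[2] (expPeriod P.t v) = κ ∧ ∃ l, v ^ P.t = v ^ Q.t ^ l := by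
  have hvQ : v ^ Q.badPart = 1 := hb ▸ hv
  have h1 : v ∈ Q.stableRoots L s (fun k => ordProj[2] k = κ) := by
    rw [heq]
    exact Q.mem_stableRoots_of_isTwist hs' hE hvQ hκ
  obtain ⟨hm, -, l, hl⟩ := h1
  have hvE : v ^ E = 1 := by
    obtain ⟨q, rfl⟩ := hE
    rw [pow_mul, hvQ, one_pow]
  rw [pow_eq_pow_of_modEq_of_pow_eq_one hvE hs.modEq] at hl
  refine ⟨?_, l, hl⟩
  have h2 : ordProj[2] (expPeriod P.t v) ≤ κ := by
    rw [← hκ]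
    exact Nat.le_of_dvd (by positivity) (Nat.ordProj_dvd_ordProj_of_dvd
      (Q.expPeriod_pos hm).ne' (expPeriod_dvd_of_pow_eq hl) 2)
  refine h2.eq_or_lt.resolve_right fun hlt => ?_
  have := ih _ hlt v hv rfl
  omega

include e in
theorem exists_pow_eq_pow_pow (κ : ℕ) (v : AlgebraicClosure ℚ) (hv : v ^ P.badPart = 1) :
    (ordProj[2] (expPeriod Q.t v) = κ →
      ordProj[2] (expPeriod P.t v) = κ ∧ ∃ l, v ^ P.t = v ^ Q.t ^ l) ∧
    (ordProj[2] (expPeriod P.t v) = κ →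
      ordProj[2] (expPeriod Q.t v) = κ ∧ ∃ l, v ^ Q.t = v ^ P.t ^ l) := by
  have hb := P.badPart_congr Q e
  have hc := card_eq_of_algEquiv e
  obtain ⟨A, E, C, hN, hodd, hEP, hCP⟩ := exists_mul_mul_eq P.card_pos.ne' P.Bad
  have hNQ := hc ▸ hN
  have hEQ : ∀ p, p.Prime → p ∣ E → Q.Bad p := fun p hp h => (P.bad_iff Q e hp).1 (hEP p hp h)
  have hCQ : ∀ p, p.Prime → p ∣ C → ¬ Q.Bad p := fun p hp h =>
    mt (P.bad_iff Q e hp).2 (hCP p hp h)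
  have hEC : E.Coprime C := coprime_of_forall_prime hEP hCP
  have hw : (2 ^ A).Coprime (E * C) := Nat.Coprime.pow_left _ hodd.coprime_two_left
  obtain ⟨s, hs⟩ := exists_isTwist (t := P.t) (by positivity) hodd hw hEC
  obtain ⟨s', hs'⟩ := exists_isTwist (t := Q.t) (by positivity) hodd hw hEC
  have hgs := hs.gcd_pred hodd hw fun p hp h => (hEP p hp h).2
  have hgs' := hs'.gcd_pred hodd hw fun p hp h => (hEQ p hp h).2
  have hcs := hs.coprime (P.t_coprime_of_bad hEP)
  have hcs' := hs'.coprime (Q.t_coprime_of_bad hEQ)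
  induction κ using Nat.strong_induction_on generalizing v with
  | _ κ ih =>
  have ih1 : ∀ κ' < κ, ∀ v : AlgebraicClosure ℚ, v ^ P.badPart = 1 →
      ordProj[2] (expPeriod P.t v) = κ' → ordProj[2] (expPeriod Q.t v) = κ' :=
    fun κ' hκ' v hv h => ((ih κ' hκ' v hv).2 h).1
  have ih2 : ∀ κ' < κ, ∀ v : AlgebraicClosure ℚ, v ^ Q.badPart = 1 →
      ordProj[2] (expPeriod Q.t v) = κ' → ordProj[2] (expPeriod P.t v) = κ' :=
    fun κ' hκ' v hv h => ((ih κ' hκ' v (hb ▸ hv)).1 h).1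
  have hsub1 := Q.stableRoots_subset hNQ hodd hEQ hCQ hs hs' (hb ▸ ih1)
  have hsub2 := P.stableRoots_subset hN hodd hEP hCP hs' hs (hb ▸ ih2)
  have hle1 := Set.ncard_le_ncard hsub1 (Q.finite_stableRoots _ _)
  have hle2 := Set.ncard_le_ncard hsub2 (P.finite_stableRoots _ _)
  have hm1 := P.gcd_mul_ncard_congr Q e hs.pos (hN ▸ hcs) hw hN (hN ▸ hgs)
    (fun k => ordProj[2] k = κ)
  have hm2 := P.gcd_mul_ncard_congr Q e hs'.pos (hN ▸ hcs') hw hN (hN ▸ hgs')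
    (fun k => ordProj[2] k = κ)
  have hp1 : 0 < Nat.gcd P.n (2 ^ A) := Nat.gcd_pos_of_pos_left _ P.n_pos
  have hp2 : 0 < Nat.gcd Q.n (2 ^ A) := Nat.gcd_pos_of_pos_left _ Q.n_pos
  have hl1 := Nat.mul_le_mul_left (Nat.gcd Q.n (2 ^ A)) hle1
  have hl2 := Nat.mul_le_mul_left (Nat.gcd P.n (2 ^ A)) hle2
  have heq1 := Set.eq_of_subset_of_ncard_le hsub1
    (Nat.le_of_mul_le_mul_left (by omega) hp2) (Q.finite_stableRoots _ _)
  have heq2 := Set.eq_of_subset_of_ncard_le hsub2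
    (Nat.le_of_mul_le_mul_left (by omega) hp1) (P.finite_stableRoots _ _)
  exact ⟨P.exists_pow_eq_of_forall Q hb (Q.badPart_dvd_of_card hNQ hCQ) hs hs' heq1 ih1 hv,
    Q.exists_pow_eq_of_forall P hb.symm (P.badPart_dvd_of_card hN hCP) hs' hs heq2 ih2 (hb ▸ hv)⟩

include e in
theorem exists_t_modEq_pow : ∃ l, P.t ≡ Q.t ^ l [MOD P.badPart] := by
  have hd : P.badPart ≠ 0 := ne_zero_of_dvd_ne_zero P.m_pos.ne' P.badPart_dvd
  have : NeZero (P.badPart : AlgebraicClosure ℚ) := ⟨Nat.cast_ne_zero.2 hd⟩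
  obtain ⟨ζ, hζ⟩ := HasEnoughRootsOfUnity.exists_primitiveRoot (AlgebraicClosure ℚ) P.badPart
  obtain ⟨l, hl⟩ := ((P.exists_pow_eq_pow_pow Q e _ ζ hζ.pow_eq_one).1 rfl).2
  exact ⟨l, hζ.eq_orderOf ▸ modEq_of_pow_eq_pow (hζ.ne_zero hd) hl⟩

end MetaPres

open Subgroup in
/-- Any metacyclic factorization yields generators and exponents. -/
theorem MetacyclicFact.exists_metaPres {G : Type*} [Group G] [Finite G] (f : MetacyclicFact G) :
    ∃ P : MetaPres G, P.m = mOf f := by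
  obtain ⟨A, B, hA, cA, cB, hcov⟩ := f
  obtain ⟨a, rfl⟩ := (Subgroup.isCyclic_iff_exists_zpowers_eq_top A).1 cA
  obtain ⟨b, rfl⟩ := (Subgroup.isCyclic_iff_exists_zpowers_eq_top B).1 cB
  have hmem : ∀ {x y : G}, y ∈ zpowers x → ∃ k : ℕ, x ^ k = y := fun h =>
    mem_powers_iff_mem_zpowers.2 h
  obtain ⟨t, ht⟩ := hmem (hA.conj_mem' a (mem_zpowers a) b)
  obtain ⟨c, hc⟩ := hmem (pow_index_mem (zpowers a) b)
  have hgen : zpowers (b : G ⧸ zpowers a) = ⊤ := by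
    refine eq_top_iff.2 fun x _ => ?_
    obtain ⟨g, rfl⟩ := QuotientGroup.mk_surjective x
    obtain ⟨x, hx, y, ⟨k, rfl⟩, rfl⟩ := hcov g
    refine ⟨k, ?_⟩
    simp only [QuotientGroup.mk_mul, QuotientGroup.mk_zpow, (QuotientGroup.eq_one_iff x).2 hx,
      one_mul]
  refine ⟨⟨a, b, orderOf a, (zpowers a).index, c, t, orderOf_pos a,
    Nat.pos_of_ne_zero index_ne_zero_of_finite, rfl, ?_, hc.symm, ?_, ?_, ?_⟩, ?_⟩
  · rw [ht, ← mul_assoc, ← mul_assoc, mul_inv_cancel, one_mul]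
  · intro j i h
    rw [index_eq_card, ← orderOf_eq_card_of_zpowers_eq_top hgen, orderOf_dvd_iff_pow_eq_one,
      ← QuotientGroup.mk_pow, QuotientGroup.eq_one_iff, h]
    exact pow_mem (mem_zpowers a) i
  · intro g
    obtain ⟨x, hx, y, hy, rfl⟩ := hcov g
    obtain ⟨i, rfl⟩ := hmem hx
    obtain ⟨j, rfl⟩ := hmem hy
    exact ⟨i, j, rfl⟩
  · rw [← Nat.card_zpowers, card_mul_index]
  · simp [mOf, Nat.card_zpowers]

theorem dvd_natPart {k e : ℕ} {σ : Set ℕ} (hk : k ≠ 0) (h : e ∣ k)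
    (he : ∀ p, p.Prime → p ∣ e → p ∈ σ) : e ∣ natPart k σ :=
  (coprime_of_forall_prime he fun _ hp h => (mem_of_dvd_natPart hp h).2).dvd_of_dvd_mul_right
    (natPart_mul_natPart_compl hk σ ▸ h)

theorem inv_pow_mul_mem {G : Type*} [Group G] {K : Subgroup G} {x : G} {q j : ℕ}
    (h : j ≡ 1 [MOD q]) (hx : x ^ q ∈ K) : (x ^ j)⁻¹ * x ∈ K := by
  obtain ⟨k, hk⟩ := Nat.modEq_iff_dvd.1 h
  have h1 : (x ^ j)⁻¹ * x = (x ^ q) ^ k := by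
    rw [← zpow_natCast x q, ← zpow_mul, ← hk, Nat.cast_one, sub_eq_neg_add, zpow_add, zpow_neg,
      zpow_one, zpow_natCast]
  rw [h1]
  exact zpow_mem hx k

namespace MetaPres

variable {G : Type*} [Group G] (P : MetaPres G)

theorem normal_closure {S : Set G} (ha : ∀ x ∈ S, P.a⁻¹ * x * P.a ∈ Subgroup.closure S)
    (hb : ∀ x ∈ S, P.b⁻¹ * x * P.b ∈ Subgroup.closure S) : (Subgroup.closure S).Normal := by
  have hgen : ∀ g : G, (∀ x ∈ S, g⁻¹ * x * g ∈ Subgroup.closure S) → ∀ (i : ℕ),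
      ∀ x ∈ Subgroup.closure S, (g ^ i)⁻¹ * x * g ^ i ∈ Subgroup.closure S := by
    intro g hg i
    have h1 : Subgroup.closure S ≤
        (Subgroup.closure S).comap (MulAut.conj g⁻¹).toMonoidHom := by
      rw [Subgroup.closure_le]
      intro x hx
      simpa using hg x hx
    induction i with
    | zero => simp
    | succ i ih =>
      intro x hx
      have h2 := h1 (ih x hx)
      rw [Subgroup.mem_comap] at h2
      convert h2 using 1
      simp [pow_succ, mul_assoc]
  refine ⟨fun x hx g => ?_⟩
  obtain ⟨i, j, hg⟩ := P.cover g⁻¹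
  have h := hgen P.b hb j _ (hgen P.a ha i x hx)
  convert h using 1
  rw [← inv_inv g, hg]
  simp [mul_assoc]

theorem b_inv_mul_a_pow_mul_b (i : ℕ) : P.b⁻¹ * P.a ^ i * P.b = P.a ^ (i * P.t) := by
  have h := P.pow_a_mul_pow i 1
  rw [pow_one, pow_one] at h
  rw [mul_assoc, h, inv_mul_cancel_left]

theorem a_inv_mul_b_pow_mul_a (l : ℕ) :
    P.a⁻¹ * P.b ^ l * P.a = P.b ^ l * ((P.a ^ P.t ^ l)⁻¹ * P.a) := by
  rw [← mul_assoc]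
  congr 1
  rw [inv_mul_eq_iff_eq_mul, ← mul_assoc, P.a_mul_pow, mul_assoc, mul_inv_cancel, mul_one]

theorem normal_zpowers (i : ℕ) : (Subgroup.zpowers (P.a ^ i)).Normal := by
  rw [Subgroup.zpowers_eq_closure]
  refine P.normal_closure ?_ ?_
  · intro x hx
    rw [Set.mem_singleton_iff.1 hx]
    have h : P.a⁻¹ * P.a ^ i * P.a = P.a ^ i := by
      rw [mul_assoc, ← pow_succ, pow_succ', inv_mul_cancel_left]
    rw [h]
    exact Subgroup.subset_closure (Set.mem_singleton _)
  · intro x hx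
    rw [Set.mem_singleton_iff.1 hx]
    rw [P.b_inv_mul_a_pow_mul_b, pow_mul]
    exact pow_mem (Subgroup.subset_closure (Set.mem_singleton _)) _

theorem coprime_card_zpowers_pow {G : Type*} [Group G] [Finite G] {p : ℕ} (hp : p.Prime) (g : G) :
    p.Coprime (Nat.card (Subgroup.zpowers (g ^ ordProj[p] (Nat.card G)))) := by
  have h0 : Nat.card G ≠ 0 := Nat.card_pos.ne'
  rw [Nat.card_zpowers]
  refine (Nat.coprime_ordCompl hp h0).coprime_dvd_right (orderOf_dvd_of_pow_eq_one ?_)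
  rw [← pow_mul, Nat.ordProj_mul_ordCompl_eq_self, pow_card_eq_one']

theorem exists_normal_of_not_bad [Finite G] {p : ℕ} (hp : p.Prime) (h : ¬ P.Bad p) :
    ∃ N : Subgroup G, N.Normal ∧ Nat.card N = ordCompl[p] (Nat.card G) := by
  have h0 := P.card_pos.ne'
  have : Fact p.Prime := ⟨hp⟩
  have hca := coprime_card_zpowers_pow hp P.a
  have hcb := coprime_card_zpowers_pow hp P.b
  set q := ordProj[p] (Nat.card G) with hq
  have hM := P.normal_zpowers q
  have hsup : Subgroup.closure {P.a ^ q, P.b ^ q} =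
      Subgroup.zpowers (P.a ^ q) ⊔ Subgroup.zpowers (P.b ^ q) := by
    rw [Set.insert_eq, Subgroup.closure_union, ← Subgroup.zpowers_eq_closure,
      ← Subgroup.zpowers_eq_closure]
  have hK : (Subgroup.closure {P.a ^ q, P.b ^ q}).Normal := by
    have haq : P.a ^ q ∈ Subgroup.closure {P.a ^ q, P.b ^ q} := Subgroup.subset_closure (by simp)
    have hbq : P.b ^ q ∈ Subgroup.closure {P.a ^ q, P.b ^ q} := Subgroup.subset_closure (by simp)
    refine P.normal_closure ?_ ?_
    · rintro _ (rfl | rfl)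
      · rwa [mul_assoc, ← pow_succ, pow_succ', inv_mul_cancel_left]
      · rw [P.a_inv_mul_b_pow_mul_a]
        refine mul_mem hbq ?_
        by_cases hpm : p ∣ P.m
        · have ht : P.t ≡ 1 [MOD p] := by
            by_contra ht
            exact h ⟨hpm, ht⟩
          exact inv_pow_mul_mem (pow_prime_pow_modEq_one ht _) haq
        · have hco : q.Coprime P.m := Nat.Coprime.pow_left _ ((Nat.Prime.coprime_iff_not_dvd hp).2 hpm)
          obtain ⟨e, he⟩ := exists_pow_eq_self_of_coprime (P.order_a ▸ hco)
          have ha : P.a ∈ Subgroup.closure {P.a ^ q, P.b ^ q} := by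
            have := pow_mem haq e
            rwa [he] at this
          exact mul_mem (inv_mem (pow_mem ha _)) ha
    · rintro _ (rfl | rfl)
      · rw [P.b_inv_mul_a_pow_mul_b, pow_mul]
        exact pow_mem haq _
      · rwa [mul_assoc, ← pow_succ, pow_succ', inv_mul_cancel_left]
  refine ⟨_, hK, ?_⟩
  have hcK : p.Coprime (Nat.card (Subgroup.closure {P.a ^ q, P.b ^ q})) := by
    rw [hsup, ← Subgroup.relIndex_bot_left, ← Subgroup.relIndex_mul_relIndex ⊥
      (Subgroup.zpowers (P.a ^ q)) _ bot_le le_sup_left, Subgroup.relIndex_bot_left,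
      Subgroup.relIndex_sup_left]
    exact hca.mul_right (hcb.coprime_dvd_right (Subgroup.relIndex_dvd_card _ _))
  have haK : P.a ^ q ∈ Subgroup.closure {P.a ^ q, P.b ^ q} := Subgroup.subset_closure (by simp)
  have hbK : P.b ^ q ∈ Subgroup.closure {P.a ^ q, P.b ^ q} := Subgroup.subset_closure (by simp)
  generalize Subgroup.closure {P.a ^ q, P.b ^ q} = K at *
  have hindex : ∃ k, K.index = p ^ k := by
    have hx : ∀ x : G, x ^ q ∈ K → IsPGroup p (Subgroup.zpowers (x : G ⧸ K)) := fun x hx =>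
      IsPGroup.of_card_dvd_pow (n := (Nat.card G).factorization p) (by
        rw [Nat.card_zpowers, orderOf_dvd_iff_pow_eq_one, ← QuotientGroup.mk_pow,
          QuotientGroup.eq_one_iff]
        exact hx)
    have hN1 : (Subgroup.zpowers (P.a : G ⧸ K)).Normal := by
      have := (P.normal_zpowers 1).map (QuotientGroup.mk' K) (QuotientGroup.mk'_surjective K)
      rwa [pow_one, MonoidHom.map_zpowers] at this
    have htop : Subgroup.zpowers (P.a : G ⧸ K) ⊔ Subgroup.zpowers (P.b : G ⧸ K) = ⊤ := by
      refine eq_top_iff.2 fun x _ => ?_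
      obtain ⟨g, rfl⟩ := QuotientGroup.mk_surjective x
      obtain ⟨i, j, rfl⟩ := P.cover g
      rw [QuotientGroup.mk_mul, QuotientGroup.mk_pow, QuotientGroup.mk_pow]
      exact Subgroup.mul_mem_sup (pow_mem (Subgroup.mem_zpowers _) _)
        (pow_mem (Subgroup.mem_zpowers _) _)
    have hp1 := (hx _ haK).to_sup_of_normal_left (hx _ hbK)
    rw [htop] at hp1
    obtain ⟨k, hk⟩ := IsPGroup.iff_card.1 hp1
    exact ⟨k, by rw [Subgroup.index_eq_card, ← hk, Subgroup.card_top]⟩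
  obtain ⟨k, hk⟩ := hindex
  have hcard := K.card_mul_index
  rw [hk] at hcard
  have hfac : (Nat.card G).factorization p = k := by
    rw [← hcard, Nat.factorization_mul Nat.card_pos.ne' (pow_pos hp.pos k).ne',
      hp.factorization_pow]
    simp [Nat.factorization_eq_zero_of_not_dvd ((Nat.Prime.coprime_iff_not_dvd hp).1 hcK)]
  rw [hq, hfac, ← hcard, Nat.mul_div_cancel _ (pow_pos hp.pos k)]

theorem not_exists_normal_of_bad [Finite G] {p : ℕ} (hp : p.Prime) (h : P.Bad p)
    {N : Subgroup G} (hN : N.Normal) : Nat.card N ≠ ordCompl[p] (Nat.card G) := by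
  intro hcard
  have h0 := P.card_pos.ne'
  set β := (Nat.card G).factorization p with hβ
  have hindex : N.index = p ^ β := by
    have h1 := N.card_mul_index
    refine Nat.eq_of_mul_eq_mul_left (Nat.card_pos (α := N)) ?_
    rw [h1, hcard, mul_comm, Nat.ordProj_mul_ordCompl_eq_self]
  have hb : (P.b : G ⧸ N) ^ p ^ β = 1 := by
    rw [← hindex, ← QuotientGroup.mk_pow, QuotientGroup.eq_one_iff]
    exact Subgroup.pow_index_mem N P.b
  have h1 := congrArg (QuotientGroup.mk' N) (P.a_mul_pow (p ^ β))
  simp only [map_mul, map_pow, QuotientGroup.mk'_apply, hb, mul_one, one_mul] at h1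
  have h2 : 1 ≡ P.t ^ p ^ β [MOD orderOf (P.a : G ⧸ N)] := by
    refine pow_inj_mod.1 ?_
    rw [pow_one]
    exact h1
  have h3 : p ∣ orderOf (P.a : G ⧸ N) := by
    have h4 : P.a ^ orderOf (P.a : G ⧸ N) ∈ N := by
      rw [← QuotientGroup.eq_one_iff, QuotientGroup.mk_pow, pow_orderOf_eq_one]
    have h5 : P.a ^ (orderOf (P.a : G ⧸ N) * Nat.card N) = 1 := by
      rw [pow_mul]
      exact orderOf_dvd_iff_pow_eq_one.1 (Subgroup.orderOf_dvd_natCard _ h4)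
    have h6 := h.1.trans (P.order_a ▸ orderOf_dvd_of_pow_eq_one h5)
    rw [hcard] at h6
    exact (Nat.coprime_ordCompl hp h0).dvd_of_dvd_mul_right h6
  exact h.2 ((pow_prime_pow_modEq_self hp _ _).symm.trans (h2.of_dvd h3).symm)

theorem mem_piSet'_iff [Finite G] {p : ℕ} (hp : p.Prime) : p ∈ piSet' G ↔ P.Bad p := by
  constructor
  · rintro ⟨⟨-, hpG⟩, h⟩
    by_contra hb
    exact h ⟨hp, hpG, P.exists_normal_of_not_bad hp hb⟩
  · intro h
    refine ⟨⟨hp, h.1.trans (P.card ▸ dvd_mul_right _ _)⟩, ?_⟩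
    rintro ⟨-, -, N, hN, hcard⟩
    exact P.not_exists_normal_of_bad hp h hN hcard

theorem natPart_piSet' [Finite G] : natPart P.m (piSet' G) = P.badPart := by
  refine Finset.prod_congr rfl fun p hp => ?_
  have h : p ∈ piSet' G ↔ p ∈ {p | P.Bad p} := P.mem_piSet'_iff (Nat.prime_of_mem_primeFactors hp)
  rw [if_congr h rfl rfl]

end MetaPres

theorem mem_zpowers_pow_div {G : Type*} [Group G] {a x : G} {m d : ℕ} (hm : 0 < m)
    (ha : orderOf a = m) (hd : d ∣ m) (hx : ∃ i : ℕ, a ^ i = x) (hxd : x ^ d = 1) :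
    x ∈ Subgroup.zpowers (a ^ (m / d)) := by
  obtain ⟨i, rfl⟩ := hx
  obtain ⟨k, rfl⟩ := hd
  have hd0 : 0 < d := Nat.pos_of_mul_pos_right hm
  rw [← pow_mul, ← orderOf_dvd_iff_pow_eq_one, ha, mul_comm i] at hxd
  obtain ⟨j, rfl⟩ := Nat.dvd_of_mul_dvd_mul_left hd0 hxd
  rw [Nat.mul_div_cancel_left _ hd0, pow_mul]
  exact pow_mem (Subgroup.mem_zpowers _) j

namespace MetaPres

variable {G : Type*} [Group G] (P : MetaPres G)

theorem commutator_le_zpowers : commutator G ≤ Subgroup.zpowers P.a := by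
  have hN := P.normal_zpowers 1
  rw [pow_one] at hN
  rw [commutator_def, Subgroup.commutator_le]
  intro g _ h _
  have hmk : ∀ g : G, ∃ j : ℕ, (g : G ⧸ Subgroup.zpowers P.a) = (P.b : G ⧸ Subgroup.zpowers P.a) ^ j := by
    intro g
    obtain ⟨i, j, rfl⟩ := P.cover g
    refine ⟨j, ?_⟩
    rw [QuotientGroup.mk_mul, (QuotientGroup.eq_one_iff _).2 (pow_mem (Subgroup.mem_zpowers _) i),
      one_mul, QuotientGroup.mk_pow]
  obtain ⟨i, hi⟩ := hmk g
  obtain ⟨j, hj⟩ := hmk h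
  rw [← QuotientGroup.eq_one_iff]
  change QuotientGroup.mk' _ _ = 1
  rw [map_commutatorElement, commutatorElement_eq_one_iff_mul_comm]
  simp only [QuotientGroup.mk'_apply, hi, hj]
  rw [← pow_add, ← pow_add, add_comm]

theorem orderOf_pow_div_badPart : orderOf (P.a ^ (P.m / P.badPart)) = P.badPart := by
  have h := P.badPart_dvd
  have h0 := ne_zero_of_dvd_ne_zero P.m_pos.ne' h
  rw [orderOf_pow_of_dvd, P.order_a, Nat.div_div_self h P.m_pos.ne']
  · exact (Nat.div_pos (Nat.le_of_dvd P.m_pos h) (Nat.pos_of_ne_zero h0)).ne'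
  · rw [P.order_a]
    exact Nat.div_dvd_of_dvd h

theorem bad_of_dvd_badPart {p : ℕ} (hp : p.Prime) (h : p ∣ P.badPart) : P.Bad p :=
  (mem_of_dvd_natPart hp h).2

theorem pow_div_badPart_mem_commutator : P.a ^ (P.m / P.badPart) ∈ commutator G := by
  set z := P.a ^ (P.m / P.badPart) with hz
  have h1 : z⁻¹ * z ^ P.t ∈ commutator G := by
    have h2 := Subgroup.commutator_mem_commutator (Subgroup.mem_top z⁻¹) (Subgroup.mem_top P.b⁻¹)
    rwa [← commutator_def, commutatorElement_def, inv_inv, inv_inv, mul_assoc, mul_assoc,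
      ← mul_assoc P.b⁻¹, hz, P.b_inv_mul_a_pow_mul_b, pow_mul] at h2
  have h3 : IsCoprime ((P.t : ℤ) - 1) (P.badPart : ℤ) := by
    rw [Int.isCoprime_iff_gcd_eq_one, Int.gcd_eq_natAbs, Int.natAbs_natCast]
    refine Nat.coprime_of_dvd fun p hp h4 h5 => (P.bad_of_dvd_badPart hp h5).2 ?_
    refine (Nat.modEq_iff_dvd.2 ?_).symm
    rw [Nat.cast_one]
    exact Int.natCast_dvd.2 h4
  obtain ⟨u, v, huv⟩ := h3
  have h4 : z ^ (P.badPart : ℤ) = 1 := by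
    rw [zpow_natCast, ← orderOf_dvd_iff_pow_eq_one, hz, P.orderOf_pow_div_badPart]
  have h5 : z = (z⁻¹ * z ^ P.t) ^ u := by
    rw [← zpow_natCast z P.t, ← zpow_neg_one, ← zpow_add, ← zpow_mul, neg_add_eq_sub, mul_comm]
    calc z = z ^ (u * (P.t - 1) + v * (P.badPart : ℤ)) := by rw [huv, zpow_one]
      _ = _ := by rw [zpow_add, mul_comm v, zpow_mul z _ v, h4, one_zpow, mul_one]
  rw [h5]
  exact zpow_mem h1 u

theorem hallOf_commutator [Finite G] :
    hallOf (commutator G) (piSet' G) = Subgroup.zpowers (P.a ^ (P.m / P.badPart)) := by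
  have hle := P.commutator_le_zpowers
  have hd0 := ne_zero_of_dvd_ne_zero P.m_pos.ne' P.badPart_dvd
  have hk0 : Nat.card (commutator G) ≠ 0 := Nat.card_pos.ne'
  have hkm : Nat.card (commutator G) ∣ P.m := by
    rw [← P.order_a, ← Nat.card_zpowers]
    exact Subgroup.card_dvd_of_le hle
  have hmem : ∀ {p}, p.Prime → p ∣ P.badPart → p ∈ piSet' G := fun hp h =>
    (P.mem_piSet'_iff hp).2 (P.bad_of_dvd_badPart hp h)
  have h1 : natPart (Nat.card (commutator G)) (piSet' G) ∣ P.badPart := by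
    rw [← P.natPart_piSet']
    exact dvd_natPart P.m_pos.ne' ((natPart_dvd hk0 _).trans hkm)
      fun p hp h => (mem_of_dvd_natPart hp h).2
  have h2 : P.badPart ∣ natPart (Nat.card (commutator G)) (piSet' G) := by
    refine dvd_natPart hk0 ?_ fun p hp h => hmem hp h
    have h := Subgroup.card_dvd_of_le (Subgroup.zpowers_le.2 P.pow_div_badPart_mem_commutator)
    rwa [Nat.card_zpowers, P.orderOf_pow_div_badPart] at h
  refine le_antisymm ?_ (Subgroup.zpowers_le.2 (Subgroup.subset_closure
    ⟨P.pow_div_badPart_mem_commutator, by rwa [P.orderOf_pow_div_badPart]⟩))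
  rw [hallOf, Subgroup.closure_le]
  rintro x ⟨hx, hxo⟩
  exact mem_zpowers_pow_div P.m_pos P.order_a P.badPart_dvd
    (mem_powers_iff_mem_zpowers.2 (hle hx)) (orderOf_dvd_iff_pow_eq_one.1 (hxo.trans h1))

theorem t_coprime_badPart : P.t.Coprime P.badPart := P.t_coprime.coprime_dvd_right P.badPart_dvd

theorem TGmod_zpowers : TGmod (Subgroup.zpowers (P.a ^ (P.m / P.badPart))) P.badPart =
    Subgroup.zpowers (ZMod.unitOfCoprime P.t P.t_coprime_badPart) := by
  set z := P.a ^ (P.m / P.badPart) with hz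
  refine le_antisymm ?_ (Subgroup.zpowers_le.2 (Subgroup.subset_closure ?_))
  · rw [TGmod, Subgroup.closure_le]
    rintro u ⟨g, s, hs, h⟩
    obtain ⟨i, j, rfl⟩ := P.cover g
    have h1 := h z (Subgroup.mem_zpowers z)
    have h2 : (P.a ^ i * P.b ^ j)⁻¹ * z * (P.a ^ i * P.b ^ j) = z ^ P.t ^ j := by
      rw [hz, ← pow_mul, mul_inv_rev, mul_assoc, mul_assoc, ← mul_assoc _ (P.a ^ i) (P.b ^ j),
        ← pow_add, add_comm, pow_add, mul_assoc, inv_mul_cancel_left, P.pow_a_mul_pow,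
        inv_mul_cancel_left]
    rw [h2, pow_inj_mod, hz, P.orderOf_pow_div_badPart] at h1
    have h3 : P.t ^ j ≡ s [MOD P.badPart] := h1
    refine ⟨j, Units.ext ?_⟩
    rw [← hs, ← (ZMod.natCast_eq_natCast_iff _ _ _).2 h3]
    simp
  · refine ⟨P.b, P.t, by simp, ?_⟩
    rintro _ ⟨k, rfl⟩
    have h2 : P.b⁻¹ * z * P.b = z ^ P.t := by
      rw [hz, P.b_inv_mul_a_pow_mul_b, pow_mul]
    have h3 : P.b⁻¹ * z ^ k * P.b = (P.b⁻¹ * z * P.b) ^ k := by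
      have := map_zpow (MulAut.conj P.b⁻¹) z k
      simpa using this
    simp only
    rw [h3, h2, ← zpow_natCast, ← zpow_natCast, ← zpow_mul, ← zpow_mul, mul_comm]

theorem mem_liftSet_ROf [Finite G] {τ : ℕ} :
    τ ∈ liftSet (ROf G P.badPart) ↔ ∃ j, τ ≡ P.t ^ j [MOD P.badPart] := by
  have : NeZero P.badPart := ⟨ne_zero_of_dvd_ne_zero P.m_pos.ne' P.badPart_dvd⟩
  rw [ROf, P.hallOf_commutator, P.TGmod_zpowers]
  constructor
  · rintro ⟨u, hu, h⟩
    obtain ⟨j, rfl⟩ := mem_powers_iff_mem_zpowers.2 hu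
    refine ⟨j, (ZMod.natCast_eq_natCast_iff _ _ _).1 ?_⟩
    rw [h]
    simp
  · rintro ⟨j, h⟩
    refine ⟨_, Subgroup.npow_mem_zpowers _ j, ?_⟩
    rw [(ZMod.natCast_eq_natCast_iff _ _ _).2 h]
    simp

theorem liftSet_ROf_subset {H : Type*} [Group H] [Finite G] [Finite H] (Q : MetaPres H)
    (e : MonoidAlgebra ℚ G ≃ₐ[ℚ] MonoidAlgebra ℚ H) :
    liftSet (ROf G P.badPart) ⊆ liftSet (ROf H Q.badPart) := by
  intro τ hτ
  obtain ⟨j, hj⟩ := P.mem_liftSet_ROf.1 hτ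
  obtain ⟨l, hl⟩ := P.exists_t_modEq_pow Q e
  refine Q.mem_liftSet_ROf.2 ⟨l * j, ?_⟩
  rw [← P.badPart_congr Q e, pow_mul]
  exact hj.trans (hl.pow j)

end MetaPres

/-- If `ℚG ≅ ℚH` for finite metacyclic `G, H`, then `(m^G)_{π'} = (m^H)_{π'}` and
`R^G = R^H` as subgroups of `(ℤ/(m^G)_{π'}ℤ)ˣ`. -/
theorem R_eq_of_qalgebra_iso {G H : Type*} [Group G] [Group H] [Finite G] [Finite H]
    (fG : MetacyclicFact G) (hfG : IsMinimalFact fG)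
    (fH : MetacyclicFact H) (hfH : IsMinimalFact fH)
    (h : Nonempty (MonoidAlgebra ℚ G ≃ₐ[ℚ] MonoidAlgebra ℚ H)) :
    natPart (mOf fG) (piSet' G) = natPart (mOf fH) (piSet' H) ∧
    liftSet (ROf G (natPart (mOf fG) (piSet' G))) =
      liftSet (ROf H (natPart (mOf fH) (piSet' H))) := by
  obtain ⟨e⟩ := h
  obtain ⟨P, hP⟩ := fG.exists_metaPres
  obtain ⟨Q, hQ⟩ := fH.exists_metaPres
  rw [← hP, ← hQ, P.natPart_piSet', Q.natPart_piSet']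
  exact ⟨P.badPart_congr Q e, (P.liftSet_ROf_subset Q e).antisymm (Q.liftSet_ROf_subset P e.symm)⟩

end ArXiv230800432
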